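/- arXiv:1701.01915 — 3 statements merged into one kernel-verified Lean document; each statement's English description precedes it below -/
import Mathlib

section
/- Let f be a primitive form of square-free level. Then for all but finitely many primes p, either λ_f(p) ∈ {0, 2, −2} or θ_p/π is irrational. -/
open scoped Real

/-- A primitive form of weight `κ` and square-free level `N`: a holomorphic cusp form for
`Γ₀(N)` with trivial character, which is a normalized Hecke eigenform for all Hecke operators
and all Atkin–Lehner involutions.  We record it via its defining properties: the underlying
cusp form, its (real) Fourier coefficients `a_f(n)`, normalization, the Hecke relations
(multiplicativity and the recurrences at prime powers, including `a_f(p) ≠ 0` for `p ∣ N`,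
which holds for newforms of square-free level by Atkin–Lehner theory), and Deligne's bound. -/
structure PrimitiveForm where
  weight : ℕ
  level : ℕ
  weight_pos : 0 < weight
  weight_even : Even weight
  level_squarefree : Squarefree level
  form : CuspForm (CongruenceSubgroup.Gamma0 level) weight
  coeff : ℕ → ℝ
  coeff_spec : ∀ z : UpperHalfPlane, HasSum
    (fun n : ℕ => (coeff n : ℂ) * Complex.exp (2 * Real.pi * Complex.I * n * (z : ℂ)))
    (form z)
  coeff_one : coeff 1 = 1
  coeff_mult : ∀ m n : ℕ, Nat.Coprime m n → coeff (m * n) = coeff m * coeff n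
  coeff_prime_dvd : ∀ p : ℕ, p.Prime → p ∣ level →
    ∀ ℓ : ℕ, coeff (p ^ (ℓ + 1)) = coeff p ^ (ℓ + 1)
  coeff_prime_dvd_ne : ∀ p : ℕ, p.Prime → p ∣ level → coeff p ≠ 0
  coeff_recurrence : ∀ p : ℕ, p.Prime → ¬p ∣ level → ∀ ℓ : ℕ,
    coeff (p ^ (ℓ + 2)) = coeff p * coeff (p ^ (ℓ + 1)) - (p : ℝ) ^ (weight - 1) * coeff (p ^ ℓ)
  deligne : ∀ p : ℕ, p.Prime → |coeff p| ≤ 2 * (p : ℝ) ^ (((weight : ℝ) - 1) / 2)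

/-- The normalized Hecke eigenvalues `λ_f(n) = a_f(n) / n^((κ-1)/2)`. -/
noncomputable def PrimitiveForm.lambda (f : PrimitiveForm) (n : ℕ) : ℝ :=
  f.coeff n / (n : ℝ) ^ (((f.weight : ℝ) - 1) / 2)

/-- The angle `θ_p ∈ [0, π]` attached to a prime `p`, defined by `λ_f(p) = 2·cos θ_p`
(by Deligne's bound, `λ_f(p) ∈ [-2, 2]`). -/
noncomputable def PrimitiveForm.theta (f : PrimitiveForm) (p : ℕ) : ℝ :=
  Real.arccos (f.lambda p / 2)


namespace LT

lemma northcott (K : IntermediateField ℚ ℂ) [FiniteDimensional ℚ K] :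
    {y : K | ∃ (u : ℂ) (n : ℕ), 0 < n ∧ u ^ n = 1 ∧ (y : ℂ) = u + u⁻¹ + 2}.Finite := by
  have : NumberField K := ⟨⟩
  refine (NumberField.Embeddings.finite_of_norm_le K ℂ 4).subset ?_
  rintro y ⟨u, n, hn, hu, hy⟩
  have hu0 : u ≠ 0 := by
    rintro rfl
    rw [zero_pow hn.ne'] at hu
    exact zero_ne_one hu
  refine ⟨?_, fun φ => ?_⟩
  · have h1 : IsIntegral ℤ u := IsIntegral.of_pow hn (by rw [hu]; exact isIntegral_one)
    have h2 : IsIntegral ℤ u⁻¹ := IsIntegral.of_pow hn (by rw [inv_pow, hu, inv_one]; exact isIntegral_one)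
    have h3 : IsIntegral ℤ (y : ℂ) := by
      rw [hy]
      exact (h1.add h2).add (by exact_mod_cast isIntegral_algebraMap (R := ℤ) (A := ℂ) (x := 2))
    exact (isIntegral_algebraMap_iff (R := ℤ) (A := K) (B := ℂ)
      (algebraMap K ℂ).injective).1 h3
  · have hd : (Polynomial.dickson 1 (1 : K) n).eval (y - 2) = 2 := by
      apply (algebraMap K ℂ).injective
      rw [← Polynomial.eval_map_apply, Polynomial.map_dickson]
      have : algebraMap K ℂ (y - 2) = u + u⁻¹ := by
        rw [map_sub, map_ofNat]
        change (y : ℂ) - 2 = _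
        rw [hy]; ring
      rw [this, map_one, Polynomial.dickson_one_one_eval_add_inv u u⁻¹ (mul_inv_cancel₀ hu0), inv_pow, hu]
      rw [map_ofNat]; norm_num
    have hd' := congrArg φ hd
    rw [← Polynomial.eval_map_apply, Polynomial.map_dickson, map_one, map_sub, map_ofNat] at hd'
    obtain ⟨w, hw⟩ : ∃ w : ℂ, w * w - (φ y - 2) * w + 1 = 0 := by
      obtain ⟨s, hs⟩ := IsAlgClosed.exists_pow_nat_eq ((φ y - 2) ^ 2 - 4) (n := 2) (by norm_num)
      refine ⟨((φ y - 2) + s) / 2, ?_⟩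
      linear_combination hs / 4
    have hw0 : w ≠ 0 := by rintro rfl; norm_num at hw
    have hw2 : φ y - 2 = w + w⁻¹ := by field_simp; linear_combination -hw
    rw [hw2, Polynomial.dickson_one_one_eval_add_inv w w⁻¹ (mul_inv_cancel₀ hw0), inv_pow] at hd'
    have hwn : w ^ n = 1 := by
      have h0 : w ^ n ≠ 0 := pow_ne_zero _ hw0
      field_simp at hd'
      have : (w ^ n - 1) ^ 2 = 0 := by linear_combination hd'
      exact sub_eq_zero.1 (pow_eq_zero_iff (two_ne_zero) |>.1 this)
    have hnw : ‖w‖ = 1 := Complex.norm_eq_one_of_pow_eq_one hwn hn.ne'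
    have : φ y = w + w⁻¹ + 2 := by rw [← hw2]; ring
    rw [this]
    calc ‖w + w⁻¹ + 2‖ ≤ ‖w‖ + ‖w⁻¹‖ + ‖(2:ℂ)‖ := norm_add₃_le
      _ = 4 := by rw [norm_inv, hnw]; norm_num

lemma trace_zero {K : Type*} [Field K] [Algebra ℚ K] [FiniteDimensional ℚ K] (x : K) (r : ℚ)
    (hr : ¬ IsSquare r) (hx : x ^ 2 = algebraMap ℚ K r) : Algebra.trace ℚ K x = 0 := by
  open Polynomial in
  have hm : minpoly ℚ x = X ^ 2 - C r := by
    symm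
    apply minpoly.eq_of_irreducible_of_monic
    · apply X_pow_sub_C_irreducible_of_prime Nat.prime_two
      intro b hb
      exact hr ⟨b, by rw [← hb]; ring⟩
    · simp [hx]
    · exact monic_X_pow_sub_C r two_ne_zero
  rw [trace_eq_finrank_mul_minpoly_nextCoeff, hm, Polynomial.nextCoeff,
    Polynomial.natDegree_X_pow_sub_C]
  simp [Polynomial.coeff_X, Polynomial.coeff_C]

lemma finite_sqrt (K : Type*) [Field K] [Algebra ℚ K] [FiniteDimensional ℚ K] (y : K) (hy : y ≠ 0) :
    {p : ℕ | p.Prime ∧ ∃ w : K, w ^ 2 = p * y}.Finite := by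
  have : CharZero K := algebraRat.charZero K
  by_contra hinf
  set S := {p : ℕ | p.Prime ∧ ∃ w : K, w ^ 2 = p * y} with hS
  have hinf : S.Infinite := hinf
  obtain ⟨p0, hp0, w0, hw0⟩ := hinf.nonempty
  have hp0' : (p0 : K) ≠ 0 := by exact_mod_cast hp0.ne_zero
  have hw0' : w0 ≠ 0 := by
    rintro rfl
    rw [zero_pow two_ne_zero] at hw0
    exact mul_ne_zero hp0' hy hw0.symm
  choose w hw using fun p : S => p.2.2
  have hli : LinearIndependent ℚ (fun p : S => w p / w0) := by
    apply LinearMap.BilinForm.linearIndependent_of_iIsOrtho (B := Algebra.traceForm ℚ K)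
    · intro p q hpq
      change Algebra.trace ℚ K (w p / w0 * (w q / w0)) = 0
      apply trace_zero _ (((p : ℕ) : ℚ) * (q : ℕ) / (p0 : ℚ) ^ 2)
      · rintro ⟨b, hb⟩
        have hp0q : (p0 : ℚ) ≠ 0 := by exact_mod_cast hp0.ne_zero
        have h1 : IsSquare ((((p : ℕ) * (q : ℕ) : ℕ)) : ℚ) := ⟨b * p0, by
          push_cast
          rw [div_eq_iff (pow_ne_zero _ hp0q)] at hb
          rw [hb]; ring⟩
        rw [Rat.isSquare_natCast_iff] at h1
        obtain ⟨c, hc⟩ := h1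
        have hpc : (p : ℕ) ∣ c := by
          have : (p : ℕ) ∣ c * c := ⟨_, hc.symm⟩
          exact (or_self_iff).1 ((p.2.1.dvd_mul).1 this)
        obtain ⟨d, rfl⟩ := hpc
        have h2 : (q : ℕ) = p * (d * d) := by
          apply Nat.eq_of_mul_eq_mul_left p.2.1.pos
          rw [hc]; ring
        have h3 : (p : ℕ) ∣ q := ⟨_, h2⟩
        exact hpq (Subtype.ext ((Nat.prime_dvd_prime_iff_eq p.2.1 q.2.1).1 h3))
      · have e1 := hw p
        have e2 := hw q
        simp only [map_div₀, map_mul, map_pow, map_natCast]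
        have : w0 ^ 2 * w0 ^ 2 = (p0 : K) ^ 2 * y ^ 2 := by rw [hw0]; ring
        rw [div_mul_div_comm, div_pow, mul_pow, e1, e2, mul_pow, this]
        field_simp
    · intro p
      change Algebra.trace ℚ K (w p / w0 * (w p / w0)) ≠ 0
      have : w p / w0 * (w p / w0) = algebraMap ℚ K ((p : ℕ) / (p0 : ℚ)) := by
        simp only [map_div₀, map_natCast]
        rw [div_mul_div_comm, ← pow_two, ← pow_two, hw p, hw0]
        field_simp
      rw [this, Algebra.trace_algebraMap]
      have hpp : ((p : ℕ) : ℚ) ≠ 0 := by exact_mod_cast p.2.1.ne_zero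
      have hp0q : (p0 : ℚ) ≠ 0 := by exact_mod_cast hp0.ne_zero
      have : Module.finrank ℚ K ≠ 0 := Module.finrank_pos.ne'
      simp [this, hpp, hp0q, hp0.ne_zero, p.2.1.ne_zero]
  have hfin : Finite S := hli.finite
  exact hinf (Set.toFinite S)

lemma arith (K : IntermediateField ℚ ℂ) [FiniteDimensional ℚ K] :
    {p : ℕ | p.Prime ∧ ∃ y : K, y ≠ 0 ∧ (∃ w : K, w ^ 2 = p * y) ∧
      ∃ (u : ℂ) (n : ℕ), 0 < n ∧ u ^ n = 1 ∧ (y : ℂ) = u + u⁻¹ + 2}.Finite := by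
  have h1 := northcott K
  refine (Set.Finite.biUnion (h1.subset (Set.inter_subset_left (t := {y | y ≠ 0})))
    (t := fun y => {p : ℕ | p.Prime ∧ ∃ w : K, w ^ 2 = p * y}) ?_).subset ?_
  · intro y hy
    exact finite_sqrt K y hy.2
  · rintro p ⟨hp, y, hy, hw, hu⟩
    simp only [Set.mem_iUnion]
    exact ⟨y, ⟨hu, hy⟩, hp, hw⟩

/-- multiplier ring of a finite dimensional subspace -/
def mulRing (L : Submodule ℚ ℂ) : Subalgebra ℚ ℂ where
  carrier := {x | ∀ l ∈ L, x * l ∈ L}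
  mul_mem' := by
    intro a b ha hb l hl
    rw [mul_assoc]; exact ha _ (hb _ hl)
  add_mem' := by
    intro a b ha hb l hl
    rw [add_mul]; exact L.add_mem (ha _ hl) (hb _ hl)
  algebraMap_mem' := by
    intro r l hl
    rw [← Algebra.smul_def]; exact L.smul_mem _ hl

lemma exists_field (L : Submodule ℚ ℂ) [FiniteDimensional ℚ L] (l : ℂ) (hl : l ∈ L) (hl0 : l ≠ 0) :
    ∃ K : IntermediateField ℚ ℂ, FiniteDimensional ℚ K ∧ ∀ x : ℂ, (∀ l ∈ L, x * l ∈ L) → x ∈ K := by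
  let φ : mulRing L →ₗ[ℚ] L :=
    { toFun := fun x => ⟨x * l, x.2 l hl⟩
      map_add' := by intro x y; ext; simp [add_mul]
      map_smul' := by intro r x; ext; simp [Algebra.smul_def, mul_assoc] }
  have hφ : Function.Injective φ := by
    intro x y hxy
    have := congrArg Subtype.val hxy
    exact Subtype.ext (mul_right_cancel₀ hl0 this)
  have hfd : FiniteDimensional ℚ (mulRing L) := FiniteDimensional.of_injective φ hφ
  have hF : IsField (mulRing L) :=
    isField_of_isIntegral_of_isField' (R := ℚ) (Field.toIsField ℚ)
  exact ⟨(mulRing L).toIntermediateField' hF, hfd, fun x hx => hx⟩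




/-- terms of the q-series -/
noncomputable def tm (c : ℕ → ℂ) (n : ℕ) (z : ℂ) : ℂ := c n * Complex.exp (2 * π * Complex.I * n * z)

/-- q-series -/
noncomputable def E (c : ℕ → ℂ) (z : ℂ) : ℂ := ∑' n : ℕ, tm c n z

/-- polynomial growth -/
def PG (c : ℕ → ℂ) (C : ℝ) (A : ℕ) : Prop := 0 ≤ C ∧ c 0 = 0 ∧ ∀ n, ‖c n‖ ≤ C * (n : ℝ) ^ A

lemma norm_tm (c : ℕ → ℂ) (n : ℕ) (z : ℂ) : ‖tm c n z‖ = ‖c n‖ * Real.exp (-(2 * π * n * z.im)) := by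
  rw [tm, norm_mul, Complex.norm_exp]
  congr 2
  simp

lemma tm_le {c : ℕ → ℂ} {C : ℝ} {A B : ℕ} (h : PG c C A) (hB : A + 2 ≤ B) (n : ℕ) {z : ℂ} {y : ℝ}
    (hy : 0 < y) (hz : y ≤ z.im) : ‖tm c n z‖ ≤ (C * B.factorial / y ^ B) * (1 / (n : ℝ) ^ 2) := by
  obtain ⟨hC, h0, hn⟩ := h
  rcases Nat.eq_zero_or_pos n with rfl | hpos
  · simp [tm, h0]
  have hn1 : (1 : ℝ) ≤ n := by exact_mod_cast hpos
  have hn0 : (0 : ℝ) < n := by linarith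
  rw [norm_tm]
  have hx : (n : ℝ) * y ≤ 2 * π * n * z.im := by
    have : (1:ℝ) ≤ 2 * π := by linarith [Real.pi_gt_three]
    calc (n:ℝ) * y ≤ n * z.im := by gcongr
      _ ≤ (2 * π) * (n * z.im) := by
        have : 0 ≤ (n:ℝ) * z.im := mul_nonneg hn0.le (hy.le.trans hz)
        nlinarith
      _ = _ := by ring
  have h1 : Real.exp (-(2 * π * n * z.im)) ≤ B.factorial / (n * y) ^ B := by
    calc Real.exp (-(2 * π * n * z.im)) ≤ Real.exp (-(n * y)) := by
          apply Real.exp_le_exp.2; linarith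
      _ = (Real.exp (n * y))⁻¹ := Real.exp_neg _
      _ ≤ ((n * y) ^ B / B.factorial)⁻¹ := by
          apply inv_anti₀ (by positivity)
          exact Real.pow_div_factorial_le_exp _ (by positivity) _
      _ = _ := inv_div _ _
  calc ‖c n‖ * Real.exp (-(2 * π * n * z.im)) ≤ (C * n ^ A) * (B.factorial / (n * y) ^ B) := by
        gcongr; exact hn n
    _ = (C * B.factorial / y ^ B) * ((n:ℝ) ^ A / n ^ B) := by rw [mul_pow]; field_simp
    _ ≤ _ := by
        apply mul_le_mul_of_nonneg_left _ (by positivity)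
        rw [div_le_div_iff₀ (by positivity) (by positivity), one_mul, ← pow_add]
        exact pow_le_pow_right₀ hn1 hB

lemma summable_inv_sq : Summable (fun n : ℕ => 1 / (n : ℝ) ^ 2) :=
  Real.summable_one_div_nat_pow.2 one_lt_two

lemma E_summable {c : ℕ → ℂ} {C : ℝ} {A : ℕ} (h : PG c C A) {z : ℂ} (hz : 0 < z.im) :
    Summable (fun n => tm c n z) :=
  Summable.of_norm_bounded (summable_inv_sq.mul_left _) (fun n => tm_le h le_rfl n hz le_rfl)

lemma E_hasSum {c : ℕ → ℂ} {C : ℝ} {A : ℕ} (h : PG c C A) {z : ℂ} (hz : 0 < z.im) :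
    HasSum (fun n => tm c n z) (E c z) := (E_summable h hz).hasSum

lemma E_bound {c : ℕ → ℂ} {C : ℝ} {A B : ℕ} (h : PG c C A) (hB : A + 2 ≤ B) :
    ∃ D : ℝ, 0 ≤ D ∧ ∀ z : ℂ, 0 < z.im → ‖E c z‖ ≤ D / z.im ^ B := by
  refine ⟨C * B.factorial * ∑' n : ℕ, 1 / (n : ℝ) ^ 2, ?_, fun z hz => ?_⟩
  · have := h.1
    have : 0 ≤ ∑' n : ℕ, 1 / (n : ℝ) ^ 2 := tsum_nonneg fun n => by positivity
    positivity
  · have := tsum_of_norm_bounded (summable_inv_sq.mul_left (C * B.factorial / z.im ^ B)).hasSum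
      (fun n => tm_le h hB n hz le_rfl)
    rw [tsum_mul_left] at this
    rw [E]
    refine this.trans (le_of_eq ?_)
    ring

/-- coefficients of iterated primitives -/
noncomputable def pc (a : ℕ → ℂ) (m n : ℕ) : ℂ := a n / (2 * π * Complex.I * n) ^ m

lemma pc_PG {a : ℕ → ℂ} {C : ℝ} {A : ℕ} (h : PG a C A) (m : ℕ) : PG (pc a m) C A := by
  refine ⟨h.1, by simp [pc, h.2.1], fun n => ?_⟩
  refine le_trans ?_ (h.2.2 n)
  rcases Nat.eq_zero_or_pos n with rfl | hpos
  · simp [pc, h.2.1]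
  rw [pc, norm_div]
  apply div_le_self (norm_nonneg _)
  rw [norm_pow]
  apply one_le_pow₀
  have hn1 : (1 : ℝ) ≤ n := by exact_mod_cast hpos
  simp only [norm_mul, Complex.norm_ofNat, Complex.norm_real, Complex.norm_I, Complex.norm_natCast,
    Real.norm_eq_abs, abs_of_pos Real.pi_pos]
  nlinarith [Real.pi_gt_three]

lemma E_hasDerivAt {a : ℕ → ℂ} {C : ℝ} {A : ℕ} (h : PG a C A) (m : ℕ) {z : ℂ} (hz : 0 < z.im) :
    HasDerivAt (E (pc a (m + 1))) (E (pc a m) z) z := by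
  have ho : IsOpen {w : ℂ | z.im / 2 < w.im} := isOpen_lt continuous_const Complex.continuous_im
  have hc : IsPreconnected {w : ℂ | z.im / 2 < w.im} :=
    (convex_halfSpace_im_gt _).isPreconnected
  have hmem : z ∈ {w : ℂ | z.im / 2 < w.im} := by simp; linarith
  refine hasDerivAt_tsum_of_isPreconnected (g := tm (pc a (m+1))) (g' := tm (pc a m))
    (summable_inv_sq.mul_left (C * (A+2).factorial / (z.im/2) ^ (A+2))) ho hc ?_ ?_ hmem
    (E_summable (pc_PG h _) hz) hmem
  · intro n w hw
    rcases Nat.eq_zero_or_pos n with rfl | hpos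
    · have h0 := h.2.1
      have e1 : tm (pc a (m+1)) 0 = fun _ => 0 := by funext z; simp [tm, pc, h0]
      have e2 : tm (pc a m) 0 w = 0 := by simp [tm, pc, h0]
      rw [e1, e2]
      exact hasDerivAt_const _ _
    · have hne : (2 * π * Complex.I * n : ℂ) ≠ 0 := by
        have := Real.pi_ne_zero
        simp [this, hpos.ne']
      have := (((hasDerivAt_id w).const_mul (2 * π * Complex.I * n : ℂ)).cexp).const_mul (pc a (m+1) n)
      refine this.congr_deriv ?_
      simp only [tm, pc, id, pow_succ]
      have hn' : (n : ℂ) ≠ 0 := by exact_mod_cast hpos.ne'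
      field_simp
  · intro n w hw
    exact tm_le (pc_PG h _) le_rfl n (by linarith) (le_of_lt hw)

/-- multi-variable primitive: `d/dz G n m z X Y = (X - z Y)^n F m z`. -/
noncomputable def G (F : ℕ → ℂ → ℂ) : ℕ → ℕ → ℂ → ℂ → ℂ → ℂ
  | 0, m, z, _, _ => F (m + 1) z
  | n + 1, m, z, X, Y => (X - z * Y) ^ (n + 1) * F (m + 1) z + (n + 1) * Y * G F n (m + 1) z X Y

lemma G_hasDerivAt {F : ℕ → ℂ → ℂ} (hF : ∀ m z, 0 < z.im → HasDerivAt (F (m+1)) (F m z) z) (n : ℕ) :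
    ∀ (m : ℕ) (z X Y : ℂ), 0 < z.im →
    HasDerivAt (fun z => G F n m z X Y) ((X - z * Y) ^ n * F m z) z := by
  induction n with
  | zero => intro m z X Y hz; simpa [G] using hF m z hz
  | succ n ih =>
    intro m z X Y hz
    have h1 : HasDerivAt (fun z => X - z * Y) (-Y) z := by
      simpa using ((hasDerivAt_id z).mul_const Y).const_sub X
    have h2 := ((h1.pow (n+1)).mul (hF m z hz)).add ((ih (m+1) z X Y hz).const_mul ((n+1) * Y))
    refine h2.congr_deriv ?_
    push_cast
    simp only [Pi.pow_apply]
    ring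

lemma G_diag (F : ℕ → ℂ → ℂ) (n : ℕ) : ∀ (m : ℕ) (z : ℂ),
    G F n m z z 1 = n.factorial * F (m + n + 1) z := by
  induction n with
  | zero => intro m z; simp [G]
  | succ n ih =>
    intro m z
    rw [G, ih, Nat.factorial_succ]
    push_cast
    rw [show m + 1 + n + 1 = m + (n + 1) + 1 by ring]
    simp
    ring

lemma G_span (F : ℕ → ℂ → ℂ) (z : ℂ) (n : ℕ) : ∀ m : ℕ, ∃ W : Submodule ℚ ℂ, FiniteDimensional ℚ W ∧
    ∀ X Y : ℚ, G F n m z X Y ∈ W := by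
  induction n with
  | zero =>
    intro m
    refine ⟨Submodule.span ℚ {F (m+1) z}, inferInstance, fun X Y => ?_⟩
    exact Submodule.subset_span rfl
  | succ n ih =>
    intro m
    obtain ⟨W, hW, h⟩ := ih (m+1)
    refine ⟨Submodule.span ℚ ((fun j => z ^ j * F (m+1) z) '' (Finset.range (n+2) : Set ℕ)) ⊔ W, ?_, fun X Y => ?_⟩
    · have : FiniteDimensional ℚ (Submodule.span ℚ ((fun j => z ^ j * F (m+1) z) '' (Finset.range (n+2) : Set ℕ))) :=
        FiniteDimensional.span_of_finite ℚ ((Finset.finite_toSet _).image _)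
      infer_instance
    · rw [G]
      apply Submodule.add_mem_sup
      · rw [sub_eq_neg_add, add_pow, Finset.sum_mul]
        apply Submodule.sum_mem
        intro j hj
        have : (-(z * (Y:ℂ))) ^ j * (X:ℂ) ^ (n + 1 - j) * ((n+1).choose j : ℂ) * F (m+1) z
          = (((-Y) ^ j * X ^ (n+1-j) * (n+1).choose j : ℚ)) • (z ^ j * F (m+1) z) := by
          rw [Algebra.smul_def, eq_ratCast]
          push_cast
          rw [neg_pow, mul_pow, neg_pow (Y:ℂ)]
          ring
        rw [this]
        apply Submodule.smul_mem
        exact Submodule.subset_span ⟨j, by simp at hj ⊢; omega, rfl⟩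
      · have : ((n:ℂ)+1) * Y * G F n (m+1) z X Y = (((n+1) * Y : ℚ)) • G F n (m+1) z X Y := by
          rw [Algebra.smul_def, eq_ratCast]; push_cast; ring
        rw [this]
        exact W.smul_mem _ (h X Y)

/-- decay along vertical lines -/
lemma G_decay {F : ℕ → ℂ → ℂ} {B : ℕ}
    (hF : ∀ m, ∃ D : ℝ, 0 ≤ D ∧ ∀ z : ℂ, 0 < z.im → ‖F m z‖ ≤ D / z.im ^ B) (n : ℕ) (hn : n < B) :
    ∀ (m : ℕ) (s : ℝ) (r X Y : ℂ), 0 < s → r.im = 0 →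
      Filter.Tendsto (fun t : ℝ => G F n m (s * t * Complex.I + r) X Y) Filter.atTop (nhds 0) := by
  have key : ∀ (m : ℕ) (j : ℕ) (_ : j < B) (s : ℝ) (r X Y : ℂ), 0 < s → r.im = 0 →
      Filter.Tendsto (fun t : ℝ => (X - (s * t * Complex.I + r) * Y) ^ j * F m (s * t * Complex.I + r))
        Filter.atTop (nhds 0) := by
    intro m j hj s r X Y hs hr
    obtain ⟨D, hD, hb⟩ := hF m
    set M : ℝ := ‖X‖ + (s + ‖r‖) * ‖Y‖ with hM
    have hM0 : 0 ≤ M := by positivity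
    have hlim : Filter.Tendsto (fun t : ℝ => (M ^ j * D / s ^ B) * t⁻¹) Filter.atTop (nhds 0) := by
      simpa using tendsto_inv_atTop_zero.const_mul (M ^ j * D / s ^ B)
    refine squeeze_zero_norm' ?_ hlim
    filter_upwards [Filter.eventually_ge_atTop (1:ℝ)] with t ht
    have him : (s * t * Complex.I + r : ℂ).im = s * t := by simp [hr]
    have ht0 : 0 < t := by linarith
    rw [norm_mul, norm_pow]
    have h1 : ‖X - (s * t * Complex.I + r) * Y‖ ≤ M * t := by
      calc ‖X - (s * t * Complex.I + r) * Y‖ ≤ ‖X‖ + ‖(s * t * Complex.I + r) * Y‖ := norm_sub_le _ _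
        _ ≤ ‖X‖ + (s * t + ‖r‖) * ‖Y‖ := by
          rw [norm_mul]
          gcongr
          refine (norm_add_le _ _).trans ?_
          simp [abs_of_pos hs, abs_of_pos ht0]
        _ ≤ ‖X‖ * t + (s * t + ‖r‖ * t) * ‖Y‖ := by
          gcongr
          · exact le_mul_of_one_le_right (norm_nonneg _) ht
          · exact le_mul_of_one_le_right (norm_nonneg _) ht
        _ = M * t := by rw [hM]; ring
    have h2 := hb (s * t * Complex.I + r) (by rw [him]; positivity)
    rw [him] at h2
    calc _ ≤ (M * t) ^ j * (D / (s * t) ^ B) := by gcongr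
      _ = (M ^ j * D / s ^ B) * (t ^ j / t ^ B) := by rw [mul_pow, mul_pow]; field_simp
      _ ≤ _ := by
        gcongr
        rw [inv_eq_one_div, div_le_div_iff₀ (by positivity) ht0, one_mul, ← pow_succ]
        exact pow_le_pow_right₀ ht hj
  induction n with
  | zero =>
    intro m s r X Y hs hr
    simpa [G] using key (m+1) 0 hn s r X Y hs hr
  | succ n ih =>
    intro m s r X Y hs hr
    have := (key (m+1) (n+1) hn s r X Y hs hr).add
      ((ih (by omega) (m+1) s r X Y hs hr).const_mul ((n+1) * Y))
    simpa [G] using this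


abbrev Mat := Matrix (Fin 2) (Fin 2) ℤ

/-- denominator -/
noncomputable def den (M : Mat) (z : ℂ) : ℂ := M 1 0 * z + M 1 1
/-- Moebius action -/
noncomputable def mob (M : Mat) (z : ℂ) : ℂ := (M 0 0 * z + M 0 1) / den M z

lemma den_ne {M : Mat} (hM : 0 < M.det) {z : ℂ} (hz : 0 < z.im) : den M z ≠ 0 := by
  intro h
  rw [Matrix.det_fin_two] at hM
  have h1 := congrArg Complex.im h
  have h2 := congrArg Complex.re h
  simp [den] at h1 h2
  rcases h1 with h1 | h1
  · simp [h1] at h2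
    simp [h1, h2] at hM
  · exact hz.ne' h1

lemma mob_im {M : Mat} (hM : 0 < M.det) {z : ℂ} (hz : 0 < z.im) : 0 < (mob M z).im := by
  have hd := den_ne hM hz
  have hn : 0 < Complex.normSq (den M z) := Complex.normSq_pos.2 hd
  have : (mob M z).im = M.det * z.im / Complex.normSq (den M z) := by
    rw [mob, Complex.div_im, Matrix.det_fin_two]
    simp only [den]
    simp
    ring
  rw [this]
  have : (0:ℝ) < M.det := by exact_mod_cast hM
  positivity

lemma den_mul {M M' : Mat} {z : ℂ} (h : den M' z ≠ 0) :
    den (M * M') z = den M (mob M' z) * den M' z := by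
  simp only [den, mob] at *
  simp [Matrix.mul_apply, Fin.sum_univ_two]
  field_simp
  ring

lemma mob_mul {M M' : Mat} {z : ℂ} (h : den M' z ≠ 0) :
    mob (M * M') z = mob M (mob M' z) := by
  rw [mob, mob, den_mul h]
  rw [show ((M * M') 0 0 : ℂ) * z + (M * M') 0 1 = (M 0 0 * mob M' z + M 0 1) * den M' z by
    simp only [den, mob] at *
    simp [Matrix.mul_apply, Fin.sum_univ_two]
    field_simp
    ring]
  rw [mul_div_mul_right _ _ h]

/-- translated primitive -/
noncomputable def GM (F : ℕ → ℂ → ℂ) (n : ℕ) (M : Mat) (z X Y : ℂ) : ℂ :=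
  G F n 0 (mob M z) (M 0 0 * X + M 0 1 * Y) (M 1 0 * X + M 1 1 * Y)

lemma GM_one (F : ℕ → ℂ → ℂ) (n : ℕ) (z X Y : ℂ) : GM F n 1 z X Y = G F n 0 z X Y := by
  simp [GM, mob, den]

lemma GM_mul (F : ℕ → ℂ → ℂ) (n : ℕ) {M M' : Mat} (hM' : 0 < M'.det) {z : ℂ} (hz : 0 < z.im) (X Y : ℂ) :
    GM F n (M * M') z X Y = GM F n M (mob M' z) (M' 0 0 * X + M' 0 1 * Y) (M' 1 0 * X + M' 1 1 * Y) := by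
  rw [GM, GM, mob_mul (den_ne hM' hz)]
  congr 1 <;> simp [Matrix.mul_apply, Fin.sum_univ_two] <;> ring

lemma mob_hasDerivAt {M : Mat} (hM : 0 < M.det) {z : ℂ} (hz : 0 < z.im) :
    HasDerivAt (mob M) (M.det / den M z ^ 2) z := by
  have hd := den_ne hM hz
  have h1 : HasDerivAt (fun z : ℂ => (M 0 0 : ℂ) * z + M 0 1) (M 0 0) z := by
    simpa using ((hasDerivAt_id z).const_mul (M 0 0 : ℂ)).add_const (M 0 1 : ℂ)
  have h2 : HasDerivAt (den M) (M 1 0) z := by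
    change HasDerivAt (fun z : ℂ => (M 1 0 : ℂ) * z + M 1 1) (M 1 0) z
    simpa using ((hasDerivAt_id z).const_mul (M 1 0 : ℂ)).add_const (M 1 1 : ℂ)
  refine (h1.div h2 hd).congr_deriv ?_
  congr 1
  rw [Matrix.det_fin_two]
  simp only [den]
  push_cast
  ring

lemma GM_hasDerivAt {F : ℕ → ℂ → ℂ} (hF : ∀ m z, 0 < z.im → HasDerivAt (F (m+1)) (F m z) z) (n : ℕ)
    {M : Mat} (hM : 0 < M.det) {z : ℂ} (hz : 0 < z.im) (X Y : ℂ) :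
    HasDerivAt (fun z => GM F n M z X Y)
      ((X - z * Y) ^ n * (M.det ^ (n + 1) / den M z ^ (n + 2) * F 0 (mob M z))) z := by
  have hd := den_ne hM hz
  have h1 := G_hasDerivAt hF n 0 (mob M z) (M 0 0 * X + M 0 1 * Y) (M 1 0 * X + M 1 1 * Y) (mob_im hM hz)
  have h2 := h1.comp z (mob_hasDerivAt hM hz)
  refine h2.congr_deriv ?_
  have : (M 0 0 * X + M 0 1 * Y) - mob M z * (M 1 0 * X + M 1 1 * Y) = (X - z * Y) * (M.det / den M z) := by
    rw [Matrix.det_fin_two, mob]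
    field_simp
    simp only [den]
    push_cast
    ring
  rw [this, mul_pow, div_pow]
  field_simp
  ring

lemma const_of_deriv {φ : ℂ → ℂ} (h : ∀ z, 0 < z.im → HasDerivAt φ 0 z) {z w : ℂ} (hz : 0 < z.im)
    (hw : 0 < w.im) : φ z = φ w := by
  have ho : IsOpen {z : ℂ | 0 < z.im} := isOpen_lt continuous_const Complex.continuous_im
  have hc : IsPreconnected {w : ℂ | 0 < w.im} := (convex_halfSpace_im_gt _).isPreconnected
  refine ho.is_const_of_deriv_eq_zero hc ?_ ?_ hz hw
  · intro x hx; exact (h x hx).differentiableAt.differentiableWithinAt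
  · intro x hx; exact (h x hx).deriv

/-- the group, as a set of matrices -/
def Gam (N : ℕ) (M : Mat) : Prop := M.det = 1 ∧ (N : ℤ) ∣ M 1 0

/-- period cocycle -/
noncomputable def P (F : ℕ → ℂ → ℂ) (n : ℕ) (M : Mat) (X Y : ℂ) : ℂ :=
  GM F n M Complex.I X Y - G F n 0 Complex.I X Y

section
variable {F : ℕ → ℂ → ℂ} {n N : ℕ}

lemma P_eq (hF : ∀ m z, 0 < z.im → HasDerivAt (F (m+1)) (F m z) z)
    (hmod : ∀ M, Gam N M → ∀ z : ℂ, 0 < z.im → F 0 (mob M z) = den M z ^ (n + 2) * F 0 z)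
    {M : Mat} (hM : Gam N M) {z : ℂ} (hz : 0 < z.im) (X Y : ℂ) :
    GM F n M z X Y = G F n 0 z X Y + P F n M X Y := by
  have hM0 : 0 < M.det := by rw [hM.1]; norm_num
  have := const_of_deriv (φ := fun z => GM F n M z X Y - G F n 0 z X Y) (fun z hz => by
    refine ((GM_hasDerivAt hF n hM0 hz X Y).sub (G_hasDerivAt hF n 0 z X Y hz)).congr_deriv ?_
    have hd := den_ne hM0 hz
    rw [hmod M hM z hz, hM.1]
    field_simp
    simp) hz (w := Complex.I) (by simp)
  rw [P, ← this]; ring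

lemma P_mul (hF : ∀ m z, 0 < z.im → HasDerivAt (F (m+1)) (F m z) z)
    (hmod : ∀ M, Gam N M → ∀ z : ℂ, 0 < z.im → F 0 (mob M z) = den M z ^ (n + 2) * F 0 z)
    {M M' : Mat} (hM : Gam N M) (hM' : Gam N M') (X Y : ℂ) :
    P F n (M * M') X Y = P F n M (M' 0 0 * X + M' 0 1 * Y) (M' 1 0 * X + M' 1 1 * Y) + P F n M' X Y := by
  have hM0 : 0 < M'.det := by rw [hM'.1]; norm_num
  have hI : 0 < Complex.I.im := by simp
  rw [P, GM_mul F n hM0 hI, P_eq hF hmod hM (mob_im hM0 hI), P, P, GM]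
  simp only [GM]
  ring

lemma P_one : P F n 1 = fun _ _ => 0 := by
  funext X Y; rw [P, GM_one, sub_self]

lemma P_span (F : ℕ → ℂ → ℂ) (n : ℕ) (M : Mat) : ∃ W : Submodule ℚ ℂ, FiniteDimensional ℚ W ∧
    ∀ X Y : ℚ, P F n M X Y ∈ W := by
  obtain ⟨W1, h1, h1'⟩ := G_span F (mob M Complex.I) n 0
  obtain ⟨W2, h2, h2'⟩ := G_span F Complex.I n 0
  refine ⟨W1 ⊔ W2, inferInstance, fun X Y => ?_⟩
  rw [P, sub_eq_add_neg]
  apply Submodule.add_mem_sup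
  · have := h1' (M 0 0 * X + M 0 1 * Y) (M 1 0 * X + M 1 1 * Y)
    rw [GM]
    exact_mod_cast this
  · exact W2.neg_mem (h2' X Y)

/-- period space -/
noncomputable def L (F : ℕ → ℂ → ℂ) (n N : ℕ) : Submodule ℚ ℂ :=
  Submodule.span ℚ {x | ∃ (M : Mat) (X Y : ℚ), Gam N M ∧ x = P F n M X Y}

lemma gam_iff (g : Matrix.SpecialLinearGroup (Fin 2) ℤ) :
    Gam N (g : Mat) ↔ g ∈ CongruenceSubgroup.Gamma0 N := by
  rw [Gam, CongruenceSubgroup.Gamma0_mem, ZMod.intCast_zmod_eq_zero_iff_dvd]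
  simp

lemma L_fd [NeZero N] (hF : ∀ m z, 0 < z.im → HasDerivAt (F (m+1)) (F m z) z)
    (hmod : ∀ M, Gam N M → ∀ z : ℂ, 0 < z.im → F 0 (mob M z) = den M z ^ (n + 2) * F 0 z) :
    FiniteDimensional ℚ (L F n N) := by
  have hfgG : Group.FG (Matrix.SpecialLinearGroup (Fin 2) ℤ) := by
    refine ⟨⟨{ModularGroup.S, ModularGroup.T}, ?_⟩⟩
    have := SpecialLinearGroup.SL2Z_generators
    simpa using this
  have hfg : (CongruenceSubgroup.Gamma0 N).FG :=
    (Group.fg_iff_subgroup_fg _).1 (Subgroup.fg_of_index_ne_zero (CongruenceSubgroup.Gamma0 N))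
  obtain ⟨S, hS⟩ := hfg
  choose W hW hW' using fun M => P_span F n M
  let V : Submodule ℚ ℂ := S.sup (fun s => W (s : Mat))
  have hV : FiniteDimensional ℚ V := Submodule.finiteDimensional_finset_sup _ _
  have key : ∀ g ∈ Subgroup.closure (S : Set (Matrix.SpecialLinearGroup (Fin 2) ℤ)),
      ∀ X Y : ℚ, P F n (g : Mat) X Y ∈ V := by
    intro g hg
    induction hg using Subgroup.closure_induction with
    | mem x hx =>
      intro X Y
      exact (Finset.le_sup (f := fun s : Matrix.SpecialLinearGroup (Fin 2) ℤ => W (s : Mat)) hx) (hW' _ X Y)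
    | one => intro X Y; rw [Matrix.SpecialLinearGroup.coe_one, P_one]; exact V.zero_mem
    | mul x y hx hy ihx ihy =>
      intro X Y
      rw [hS] at hx hy
      rw [Matrix.SpecialLinearGroup.coe_mul, P_mul hF hmod ((gam_iff _).2 hx) ((gam_iff _).2 hy)]
      refine V.add_mem ?_ (ihy X Y)
      exact_mod_cast ihx ((y : Mat) 0 0 * X + (y : Mat) 0 1 * Y) ((y : Mat) 1 0 * X + (y : Mat) 1 1 * Y)
    | inv x hx ih =>
      intro X Y
      rw [hS] at hx
      have h1 := P_mul hF hmod ((gam_iff _).2 hx) ((gam_iff _).2 (inv_mem hx)) X Y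
      rw [← Matrix.SpecialLinearGroup.coe_mul, mul_inv_cancel, Matrix.SpecialLinearGroup.coe_one, P_one] at h1
      rw [eq_neg_of_add_eq_zero_right h1.symm]
      refine V.neg_mem ?_
      set y := x⁻¹
      exact_mod_cast ih ((y : Mat) 0 0 * X + (y : Mat) 0 1 * Y) ((y : Mat) 1 0 * X + (y : Mat) 1 1 * Y)
  have hle : L F n N ≤ V := by
    rw [L, Submodule.span_le]
    rintro x ⟨M, X, Y, hM, rfl⟩
    have := key ⟨M, hM.1⟩ (by rw [hS]; exact (gam_iff (⟨M, hM.1⟩ : Matrix.SpecialLinearGroup (Fin 2) ℤ)).1 hM) X Y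
    exact this
  exact Submodule.finiteDimensional_of_le hle

/-- Hecke representatives -/
def al (p : ℕ) : Option (Fin p) → Mat
  | none => !![(p : ℤ), 0; 0, 1]
  | some b => !![1, (b : ℤ); 0, (p : ℤ)]

lemma al_det (p : ℕ) (i : Option (Fin p)) : (al p i).det = p := by
  cases i <;> simp [al, Matrix.det_fin_two]

lemma al_coset {p : ℕ} (hp : p.Prime) (hpN : ¬ p ∣ N) {g : Mat} (hg : Gam N g) (i : Option (Fin p)) :
    ∃ (j : Option (Fin p)) (g' : Mat), Gam N g' ∧ al p i * g = g' * al p j := by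
  have hpp : Prime (p : ℤ) := Nat.prime_iff_prime_int.1 hp
  have hp0 : (p : ℤ) ≠ 0 := by exact_mod_cast hp.ne_zero
  obtain ⟨A, hA⟩ : ∃ A, A = al p i * g := ⟨_, rfl⟩
  have hdet : A 0 0 * A 1 1 - A 0 1 * A 1 0 = p := by
    rw [← Matrix.det_fin_two, hA, Matrix.det_mul, al_det, hg.1, mul_one]
  have hC : (N : ℤ) ∣ A 1 0 := by
    have : A 1 0 = (al p i) 1 1 * g 1 0 := by
      rw [hA, Matrix.mul_apply, Fin.sum_univ_two]
      cases i <;> simp [al]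
    rw [this]; exact hg.2.mul_left _
  rw [← hA]
  by_cases h : (p : ℤ) ∣ A 0 0 ∧ (p : ℤ) ∣ A 1 0
  · obtain ⟨⟨a, ha⟩, ⟨c, hc⟩⟩ := h
    refine ⟨none, !![a, A 0 1; c, A 1 1], ⟨?_, ?_⟩, ?_⟩
    · rw [Matrix.det_fin_two]
      simp
      apply mul_left_cancel₀ hp0
      rw [ha, hc] at hdet
      linear_combination hdet
    · simp
      rw [hc] at hC
      refine IsCoprime.dvd_of_dvd_mul_left ?_ hC
      rw [Int.isCoprime_iff_gcd_eq_one, Int.gcd_natCast_natCast]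
      exact ((Nat.Prime.coprime_iff_not_dvd hp).2 hpN).symm
    · ext r s
      fin_cases r <;> fin_cases s <;> simp [al, Matrix.mul_apply, Fin.sum_univ_two, ha, hc, mul_comm]
  · obtain ⟨b, hb1, hb2⟩ : ∃ b : ℤ, (p : ℤ) ∣ A 0 1 - A 0 0 * b ∧ (p : ℤ) ∣ A 1 1 - A 1 0 * b := by
      have hcop : ∀ x : ℤ, ¬ (p : ℤ) ∣ x → ∃ u : ℤ, (p : ℤ) ∣ 1 - x * u := by
        intro x hx
        obtain ⟨u, v, huv⟩ := (hpp.coprime_iff_not_dvd.2 hx)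
        exact ⟨v, ⟨u, by linear_combination -huv⟩⟩
      rcases not_and_or.1 h with h | h
      · obtain ⟨u, k, hk⟩ := hcop _ h
        refine ⟨u * A 0 1, ⟨k * A 0 1, by linear_combination (A 0 1) * hk⟩, ?_⟩
        refine ⟨k * A 1 1 + u, ?_⟩
        linear_combination (A 1 1) * hk + u * hdet
      · obtain ⟨u, k, hk⟩ := hcop _ h
        refine ⟨u * A 1 1, ?_, ⟨k * A 1 1, by linear_combination (A 1 1) * hk⟩⟩
        refine ⟨k * A 0 1 - u, ?_⟩
        linear_combination (A 0 1) * hk - u * hdet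
    have hbm : (p : ℤ) ∣ b - b % p := ⟨b / p, by have := Int.mul_ediv_add_emod b p; linarith⟩
    have hlt : (b % p).toNat < p := by
      have h1 := Int.emod_lt_of_pos b (show (0:ℤ) < p by exact_mod_cast hp.pos)
      have h2 := Int.emod_nonneg b hp0
      omega
    have hcast : (((b % p).toNat : ℕ) : ℤ) = b % p := Int.toNat_of_nonneg (Int.emod_nonneg b hp0)
    obtain ⟨q, hq⟩ := hbm
    obtain ⟨x, hx⟩ := hb1
    obtain ⟨y, hy⟩ := hb2
    refine ⟨some ⟨(b % p).toNat, hlt⟩, !![A 0 0, x + A 0 0 * q; A 1 0, y + A 1 0 * q], ⟨?_, ?_⟩, ?_⟩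
    · rw [Matrix.det_fin_two]
      simp
      apply mul_left_cancel₀ hp0
      linear_combination hdet - A 0 0 * hy + A 1 0 * hx
    · simpa using hC
    · ext r s
      fin_cases r <;> fin_cases s <;> simp [al, Matrix.mul_apply, Fin.sum_univ_two, hcast]
      · linear_combination hx + A 0 0 * hq
      · linear_combination hy + A 1 0 * hq

lemma al_inj {p : ℕ} (hp : p.Prime) {d : Mat} (hd : d.det = 1) {i i' : Option (Fin p)}
    (h : d * al p i' = al p i) : i = i' := by
  have e00 := congrFun (congrFun h 0) 0
  have e01 := congrFun (congrFun h 0) 1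
  have e10 := congrFun (congrFun h 1) 0
  have e11 := congrFun (congrFun h 1) 1
  rw [Matrix.det_fin_two] at hd
  have h1 : ∀ x : ℤ, x * p ≠ 1 := by
    intro x hx
    have : (p : ℤ) ∣ 1 := ⟨x, by linarith⟩
    have := Int.natCast_dvd_natCast.1 (by exact_mod_cast this : ((p : ℕ) : ℤ) ∣ ((1 : ℕ) : ℤ))
    exact hp.one_lt.ne' (Nat.dvd_one.1 this)
  rcases i with _ | b <;> rcases i' with _ | b'
  · rfl
  · exfalso
    simp [al, Matrix.mul_apply, Fin.sum_univ_two] at e00 e01 e10 e11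
    rw [e00, e10] at hd
    exact h1 (d 1 1) (by linarith)
  · exfalso
    simp [al, Matrix.mul_apply, Fin.sum_univ_two] at e00 e01 e10 e11
    exact h1 _ e00
  · simp [al, Matrix.mul_apply, Fin.sum_univ_two] at e00 e01 e10 e11
    rw [e00, one_mul] at e01
    congr 1
    apply Fin.ext
    have h3 : ((b : ℕ) : ℤ) % p = ((b' : ℕ) : ℤ) % p := by rw [← e01]; simp
    rw [Int.emod_eq_of_lt (by positivity) (by exact_mod_cast b.2),
      Int.emod_eq_of_lt (by positivity) (by exact_mod_cast b'.2)] at h3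
    exact_mod_cast h3

lemma hecke_G {B : ℕ} (hF : ∀ m z, 0 < z.im → HasDerivAt (F (m+1)) (F m z) z)
    (hb : ∀ m, ∃ D : ℝ, 0 ≤ D ∧ ∀ z : ℂ, 0 < z.im → ‖F m z‖ ≤ D / z.im ^ B) (hn : n < B)
    {p : ℕ} (hp : p.Prime) {a : ℂ}
    (hT : ∀ z : ℂ, 0 < z.im →
      ∑ i, ((p : ℂ) ^ (n+1) / den (al p i) z ^ (n+2) * F 0 (mob (al p i) z)) = a * F 0 z)
    {z : ℂ} (hz : 0 < z.im) (X Y : ℂ) :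
    ∑ i, GM F n (al p i) z X Y = a * G F n 0 z X Y := by
  have hdp : ∀ i, 0 < (al p i).det := fun i => by rw [al_det]; exact_mod_cast hp.pos
  set φ : ℂ → ℂ := fun z => ∑ i, GM F n (al p i) z X Y - a * G F n 0 z X Y with hφ
  have hder : ∀ z, 0 < z.im → HasDerivAt φ 0 z := by
    intro z hz
    have h1 := HasDerivAt.fun_sum (u := Finset.univ) (fun i _ => GM_hasDerivAt hF n (hdp i) hz X Y)
    refine (h1.sub ((G_hasDerivAt hF n 0 z X Y hz).const_mul a)).congr_deriv ?_
    rw [← Finset.mul_sum]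
    simp only [al_det, Int.cast_natCast]
    rw [hT z hz]
    ring
  have hlim : Filter.Tendsto (fun t : ℝ => φ (t * Complex.I)) Filter.atTop (nhds 0) := by
    have hp0 : (0:ℝ) < p := by exact_mod_cast hp.pos
    have h0 := G_decay hb n hn 0 1 0 X Y one_pos (by simp)
    have h1 : ∀ i, Filter.Tendsto (fun t : ℝ => GM F n (al p i) (t * Complex.I) X Y) Filter.atTop (nhds 0) := by
      intro i
      cases i with
      | none =>
        have := G_decay hb n hn 0 p 0 (p * X) Y hp0 (by simp)
        refine this.congr fun t => ?_
        simp [GM, al, mob, den]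
        ring_nf
      | some b =>
        have := G_decay hb n hn 0 (1/p) ((b : ℕ) / (p : ℕ) : ℝ) (X + (b:ℕ) * Y) (p * Y) (by positivity) (Complex.ofReal_im _)
        refine this.congr fun t => ?_
        simp [GM, al, mob, den]
        congr 1
        ring
    have h2 := (tendsto_finsetSum Finset.univ (fun i _ => h1 i)).sub (h0.const_mul a)
    simpa [hφ] using h2
  have hconst : ∀ᶠ t : ℝ in Filter.atTop, φ z = φ (t * Complex.I) := by
    filter_upwards [Filter.eventually_gt_atTop 0] with t ht
    exact const_of_deriv hder hz (by simpa using ht)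
  have h3 : φ z = 0 :=
    tendsto_nhds_unique (tendsto_const_nhds.congr' hconst) hlim
  exact sub_eq_zero.1 h3

lemma L_hecke {B : ℕ} (hF : ∀ m z, 0 < z.im → HasDerivAt (F (m+1)) (F m z) z)
    (hmod : ∀ M, Gam N M → ∀ z : ℂ, 0 < z.im → F 0 (mob M z) = den M z ^ (n + 2) * F 0 z)
    (hb : ∀ m, ∃ D : ℝ, 0 ≤ D ∧ ∀ z : ℂ, 0 < z.im → ‖F m z‖ ≤ D / z.im ^ B) (hn : n < B)
    {p : ℕ} (hp : p.Prime) (hpN : ¬ p ∣ N) {a : ℂ}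
    (hT : ∀ z : ℂ, 0 < z.im →
      ∑ i, ((p : ℂ) ^ (n+1) / den (al p i) z ^ (n+2) * F 0 (mob (al p i) z)) = a * F 0 z) :
    ∀ l ∈ L F n N, a * l ∈ L F n N := by
  have hdp : ∀ i, 0 < (al p i).det := fun i => by rw [al_det]; exact_mod_cast hp.pos
  intro l hl
  induction hl using Submodule.span_induction with
  | zero => rw [mul_zero]; exact Submodule.zero_mem _
  | add x y _ _ hx hy => rw [mul_add]; exact Submodule.add_mem _ hx hy
  | smul r x _ hx => rw [mul_smul_comm]; exact Submodule.smul_mem _ _ hx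
  | mem x hx =>
    obtain ⟨g, X, Y, hg, rfl⟩ := hx
    choose σ γ hγ hσ using fun i => al_coset hp hpN hg i
    have hI : 0 < Complex.I.im := by simp
    have hg0 : 0 < g.det := by rw [hg.1]; norm_num
    have hinj : Function.Injective σ := by
      intro i i' hii
      have e1 := hσ i
      have e2 := hσ i'
      rw [← hii] at e2
      have hg2 : (γ i').adjugate * γ i' = 1 := by rw [Matrix.adjugate_mul, (hγ i').1, one_smul]
      have hgg : g * g.adjugate = 1 := by rw [Matrix.mul_adjugate, hg.1, one_smul]
      have e3 : (γ i').adjugate * (al p i' * g) = al p (σ i) := by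
        rw [e2, ← mul_assoc, hg2, one_mul]
      refine al_inj hp (d := γ i * (γ i').adjugate) ?_ ?_
      · rw [Matrix.det_mul, Matrix.det_adjugate, (hγ i).1, (hγ i').1]; simp
      · have e4 : γ i * (γ i').adjugate * al p i' * g = al p i * g := by
          rw [e1, ← e3]; simp only [mul_assoc]
        have := congrArg (· * g.adjugate) e4
        simpa only [mul_assoc, hgg, mul_one] using this
    have hbij : Function.Bijective σ := Finite.injective_iff_bijective.1 hinj
    have hsum := hecke_G hF hb hn hp hT (mob_im hg0 hI) (g 0 0 * X + g 0 1 * Y) (g 1 0 * X + g 1 1 * Y)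
    have hsum0 := hecke_G hF hb hn hp hT hI (X : ℂ) Y
    have hterm : ∀ i, GM F n (al p i) (mob g Complex.I) (g 0 0 * X + g 0 1 * Y) (g 1 0 * X + g 1 1 * Y)
        = GM F n (al p (σ i)) Complex.I X Y + P F n (γ i)
          ((al p (σ i)) 0 0 * X + (al p (σ i)) 0 1 * Y) ((al p (σ i)) 1 0 * X + (al p (σ i)) 1 1 * Y) := by
      intro i
      rw [← GM_mul F n hg0 hI, hσ i, GM_mul F n (hdp _) hI, P_eq hF hmod (hγ i) (mob_im (hdp _) hI)]
      rfl
    rw [Finset.sum_congr rfl (fun i _ => hterm i), Finset.sum_add_distrib,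
      hbij.sum_comp (fun i => GM F n (al p i) Complex.I X Y), hsum0] at hsum
    have : a * P F n g X Y = ∑ i, P F n (γ i)
          ((al p (σ i)) 0 0 * X + (al p (σ i)) 0 1 * Y) ((al p (σ i)) 1 0 * X + (al p (σ i)) 1 1 * Y) := by
      rw [P, mul_sub, GM, ← hsum]; ring
    rw [this]
    apply Submodule.sum_mem
    intro i _
    apply Submodule.subset_span
    exact ⟨γ i, (al p (σ i)) 0 0 * X + (al p (σ i)) 0 1 * Y, (al p (σ i)) 1 0 * X + (al p (σ i)) 1 1 * Y,
      hγ i, by push_cast; rfl⟩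

end

end LT

open scoped Real
namespace LT

lemma root_sum {p : ℕ} (hp : p.Prime) (m : ℕ) :
    ∑ b : Fin p, Complex.exp (2 * π * Complex.I * m * ((b : ℕ) / p)) = if p ∣ m then (p : ℂ) else 0 := by
  have hp0 : (p : ℂ) ≠ 0 := by exact_mod_cast hp.ne_zero
  have hζ := Complex.isPrimitiveRoot_exp p hp.ne_zero
  set ζ := Complex.exp (2 * π * Complex.I / p) with hζd
  have e : ∀ b : Fin p, Complex.exp (2 * π * Complex.I * m * ((b : ℕ) / p)) = (ζ ^ m) ^ (b : ℕ) := by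
    intro b
    rw [hζd, ← Complex.exp_nat_mul, ← Complex.exp_nat_mul]
    congr 1
    field_simp
  simp_rw [e]
  rw [Fin.sum_univ_eq_sum_range (fun i => (ζ ^ m) ^ i) p]
  split_ifs with h
  · rw [(hζ.pow_eq_one_iff_dvd m).2 h]; simp
  · exact (hζ.pow_of_coprime m ((Nat.Prime.coprime_iff_not_dvd hp).2 h).symm).geom_sum_eq_zero hp.one_lt

lemma hecke_E {a : ℕ → ℂ} {C : ℝ} {A : ℕ} (h : PG a C A) {p : ℕ} (hp : p.Prime) (n : ℕ) {ap : ℂ}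
    (hrel : ∀ m, ap * a m = a (p * m) + (p : ℂ) ^ (n+1) * (if p ∣ m then a (m / p) else 0))
    {z : ℂ} (hz : 0 < z.im) :
    ∑ i, ((p : ℂ) ^ (n+1) / den (al p i) z ^ (n+2) * E a (mob (al p i) z)) = ap * E a z := by
  have hp0 : (p : ℂ) ≠ 0 := by exact_mod_cast hp.ne_zero
  have hpR : (0 : ℝ) < p := by exact_mod_cast hp.pos
  have hinj : Function.Injective (fun m : ℕ => p * m) := fun x y hxy => Nat.eq_of_mul_eq_mul_left hp.pos hxy
  have hnr : ∀ x, x ∉ Set.range (fun m : ℕ => p * m) → ¬ p ∣ x := by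
    rintro x hx ⟨y, rfl⟩; exact hx ⟨y, rfl⟩
  have hdet : ∀ i, 0 < (al p i).det := fun i => by rw [al_det]; exact_mod_cast hp.pos
  rw [Fintype.sum_option]
  have d1 : den (al p none) z = 1 := by simp [den, al]
  have m1 : mob (al p none) z = p * z := by rw [mob, d1]; simp [al]
  have d2 : ∀ b, den (al p (some b)) z = p := fun b => by simp [den, al]
  have m2 : ∀ b, mob (al p (some b)) z = (z + (b : ℕ)) / p := fun b => by rw [mob, d2]; simp [al]
  have i1 : 0 < ((p:ℂ) * z).im := by rw [← m1]; exact mob_im (hdet _) hz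
  have i2 : ∀ b : Fin p, 0 < ((z + (b : ℕ)) / p).im := fun b => by rw [← m2 b]; exact mob_im (hdet _) hz
  simp_rw [d2, m2]
  rw [d1, m1]
  -- first term
  have s1 : HasSum (fun m => tm (fun m => if p ∣ m then a (m / p) else 0) m z) (E a (p * z)) := by
    rw [← hinj.hasSum_iff (fun x hx => by simp [tm, hnr x hx])]
    convert E_hasSum h i1 using 2 with m
    simp [tm, hp.pos]
    left; congr 1; ring
  have s2 : HasSum (fun m => (p:ℂ) * tm (fun m => a (p * m)) m z) (∑ b : Fin p, E a ((z + (b : ℕ)) / p)) := by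
    have h1 : HasSum (fun m => ∑ b : Fin p, tm a m ((z + (b : ℕ)) / p)) (∑ b : Fin p, E a ((z + (b : ℕ)) / p)) :=
      hasSum_sum fun b _ => E_hasSum h (i2 b)
    have h2 : ∀ m, ∑ b : Fin p, tm a m ((z + (b : ℕ)) / p) =
        a m * Complex.exp (2 * π * Complex.I * m * (z / p)) * (if p ∣ m then (p : ℂ) else 0) := by
      intro m
      rw [← root_sum hp m, Finset.mul_sum]
      refine Finset.sum_congr rfl fun b _ => ?_
      rw [tm, mul_assoc (a m), ← Complex.exp_add]
      congr 2
      field_simp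
    simp_rw [h2] at h1
    rw [← hinj.hasSum_iff (fun x hx => by simp [hnr x hx])] at h1
    convert h1 using 2 with m
    simp [tm]
    rw [show (2 * π * Complex.I * (p * m) * (z / p) : ℂ) = 2 * π * Complex.I * m * z by field_simp]
    ring
  have s3 : HasSum (fun m => ap * tm a m z) (ap * E a z) := (E_hasSum h hz).mul_left _
  have s4 := (s1.mul_left ((p:ℂ)^(n+1))).add (s2.mul_left ((p:ℂ)⁻¹))
  have s5 : HasSum (fun m => ap * tm a m z) ((p:ℂ)^(n+1) * E a (p * z) +
      (p:ℂ)⁻¹ * ∑ b : Fin p, E a ((z + (b : ℕ)) / p)) := by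
    have e : (fun m => ap * tm a m z) = fun m => (p:ℂ)^(n+1) * tm (fun m => if p ∣ m then a (m / p) else 0) m z +
        (p:ℂ)⁻¹ * ((p:ℂ) * tm (fun m => a (p * m)) m z) := by
      funext m
      simp only [tm]
      rw [← mul_assoc ap, hrel, inv_mul_cancel_left₀ hp0]
      ring
    rw [e]
    exact s4
  rw [s3.unique s5, ← Finset.mul_sum]
  simp only [one_pow, div_one]
  congr 2
  rw [pow_succ _ (n+1)]; field_simp

lemma hecke_rel (f : PrimitiveForm) (hf0 : f.coeff 0 = 0) {p : ℕ} (hp : p.Prime) (hpN : ¬ p ∣ f.level) (m : ℕ) :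
    f.coeff p * f.coeff m = f.coeff (p * m) + (p:ℝ) ^ (f.weight - 1) * (if p ∣ m then f.coeff (m / p) else 0) := by
  rcases Nat.eq_zero_or_pos m with rfl | hm
  · simp [hf0]
  obtain ⟨l, m', hm', rfl⟩ := Nat.exists_eq_pow_mul_and_not_dvd hm.ne' p hp.ne_one
  have hc : ∀ j, Nat.Coprime (p ^ j) m' := fun j => ((Nat.Prime.coprime_iff_not_dvd hp).2 hm').pow_left j
  cases l with
  | zero =>
    have h1 := f.coeff_mult p m' (by simpa using hc 1)
    simp [hm', h1]
  | succ l =>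
    have h1 : p * (p ^ (l+1) * m') = p ^ (l+2) * m' := by ring
    have h2 : p ^ (l+1) * m' / p = p ^ l * m' := by
      rw [show p ^ (l+1) * m' = p * (p ^ l * m') by ring, Nat.mul_div_cancel_left _ hp.pos]
    have h3 : p ∣ p ^ (l+1) * m' := ⟨p ^ l * m', by ring⟩
    rw [if_pos h3, h1, h2, f.coeff_mult _ _ (hc _), f.coeff_mult _ _ (hc _), f.coeff_mult _ _ (hc _),
      f.coeff_recurrence p hp hpN l]
    ring

lemma level_ne (f : PrimitiveForm) : f.level ≠ 0 := f.level_squarefree.ne_zero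

lemma one_mem_per (N : ℕ) : (1:ℝ) ∈ (Subgroup.map (Matrix.SpecialLinearGroup.mapGL ℝ)
    (CongruenceSubgroup.Gamma0 N)).strictPeriods := by
  rw [CongruenceSubgroup.strictPeriods_Gamma0]; exact AddSubgroup.mem_zmultiples 1

lemma coeff_eq (f : PrimitiveForm) (m : ℕ) :
    (f.coeff m : ℂ) = (UpperHalfPlane.qExpansion 1 f.form).coeff m := by
  refine ModularFormClass.qExpansion_coeff_unique (c := fun m => (f.coeff m : ℂ)) one_pos (one_mem_per f.level) (fun τ => ?_) m
  convert f.coeff_spec τ using 2 with j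
  rw [Function.Periodic.qParam, ← Complex.exp_nat_mul, smul_eq_mul]
  congr 2
  push_cast
  ring

lemma coeff_zero (f : PrimitiveForm) : f.coeff 0 = 0 := by
  have := coeff_eq f 0
  rw [CuspFormClass.qExpansion_coeff_zero f.form one_pos (one_mem_per f.level)] at this
  exact_mod_cast this

lemma coeff_PG (f : PrimitiveForm) : ∃ C, PG (fun j => (f.coeff j : ℂ)) C f.weight := by
  have : NeZero f.level := ⟨level_ne f⟩
  have h := ModularFormClass.qExpansion_isBigO (k := f.weight) (by positivity) f.form
  have hw : (Subgroup.map (Matrix.SpecialLinearGroup.mapGL ℝ)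
    (CongruenceSubgroup.Gamma0 f.level)).strictWidthInfty = 1 := by
    exact CongruenceSubgroup.strictWidthInfty_Gamma0 _
  rw [hw] at h
  simp_rw [← coeff_eq f] at h
  rw [← Nat.cofinite_eq_atTop] at h
  obtain ⟨C, hC, hb⟩ := Asymptotics.bound_of_isBigO_cofinite h
  refine ⟨C, hC.le, by simp [coeff_zero f], fun m => ?_⟩
  rcases Nat.eq_zero_or_pos m with rfl | hm
  · simp [coeff_zero f]; positivity
  have := hb (x := m) (by positivity)
  simpa using this

/-- the coefficients -/
noncomputable def cf (f : PrimitiveForm) (j : ℕ) : ℂ := f.coeff j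
/-- the tower -/
noncomputable def FF (f : PrimitiveForm) (m : ℕ) : ℂ → ℂ := E (pc (cf f) m)

lemma pc_zero (a : ℕ → ℂ) : pc a 0 = a := by funext n; simp [pc]

lemma FF_zero (f : PrimitiveForm) (z : UpperHalfPlane) : FF f 0 z = f.form z := by
  obtain ⟨C, hC⟩ := coeff_PG f
  rw [FF, pc_zero]
  exact (E_hasSum (c := cf f) hC z.2).unique (f.coeff_spec z)

lemma FF_deriv (f : PrimitiveForm) : ∀ m z, 0 < z.im → HasDerivAt (FF f (m+1)) (FF f m z) z := by
  obtain ⟨C, hC⟩ := coeff_PG f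
  intro m z hz
  exact E_hasDerivAt (a := cf f) hC m hz

lemma FF_bound (f : PrimitiveForm) : ∀ m, ∃ D : ℝ, 0 ≤ D ∧ ∀ z : ℂ, 0 < z.im → ‖FF f m z‖ ≤ D / z.im ^ (f.weight + 2) := by
  obtain ⟨C, hC⟩ := coeff_PG f
  intro m
  exact E_bound (pc_PG (a := cf f) hC m) le_rfl

lemma weight_eq (f : PrimitiveForm) : f.weight = (f.weight - 2) + 2 := by
  obtain ⟨r, hr⟩ := f.weight_even
  have := f.weight_pos
  omega

lemma smul_mob (g : Matrix.SpecialLinearGroup (Fin 2) ℤ) (z : UpperHalfPlane) :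
    ((g • z : UpperHalfPlane) : ℂ) = mob (g : Mat) z := by
  rw [UpperHalfPlane.coe_specialLinearGroup_apply]
  simp [mob, den]

lemma denom_den (g : Matrix.SpecialLinearGroup (Fin 2) ℤ) (z : ℂ) :
    UpperHalfPlane.denom (Matrix.SpecialLinearGroup.toGL ((Matrix.SpecialLinearGroup.map (Int.castRingHom ℝ)) g)) z
      = den (g : Mat) z := by
  simp [UpperHalfPlane.denom, den]

lemma FF_mod (f : PrimitiveForm) : ∀ M, Gam f.level M → ∀ z : ℂ, 0 < z.im →
    FF f 0 (mob M z) = den M z ^ (f.weight - 2 + 2) * FF f 0 z := by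
  intro M hM z hz
  obtain ⟨g, rfl⟩ : ∃ g : Matrix.SpecialLinearGroup (Fin 2) ℤ, (g : Mat) = M := ⟨⟨M, hM.1⟩, rfl⟩
  have h := SlashInvariantForm.slash_action_eqn_SL'' f.form ((gam_iff (N := f.level) g).1 hM) ⟨z, hz⟩
  rw [← FF_zero, ← FF_zero, smul_mob, denom_den] at h
  rw [← weight_eq]
  exact_mod_cast h

lemma LL_hecke (f : PrimitiveForm) {p : ℕ} (hp : p.Prime) (hpN : ¬ p ∣ f.level) :
    ∀ l ∈ L (FF f) (f.weight - 2) f.level, (f.coeff p : ℂ) * l ∈ L (FF f) (f.weight - 2) f.level := by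
  obtain ⟨C, hC⟩ := coeff_PG f
  refine L_hecke (FF_deriv f) (FF_mod f) (FF_bound f) (by omega) hp hpN (fun z hz => ?_)
  rw [FF, pc_zero]
  refine hecke_E (a := cf f) hC hp _ (fun m => ?_) hz
  have := hecke_rel f (coeff_zero f) hp hpN m
  have e : f.weight - 2 + 1 = f.weight - 1 := by have := weight_eq f; omega
  rw [e]
  simp only [cf]
  have h2 := congrArg (fun x : ℝ => (x : ℂ)) this
  split_ifs at h2 ⊢ <;> push_cast at h2 <;> exact h2

end LT

open scoped Real
namespace LT

lemma G_homog (F : ℕ → ℂ → ℂ) (n : ℕ) : ∀ (m : ℕ) (z t X Y : ℂ),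
    G F n m z (t * X) (t * Y) = t ^ n * G F n m z X Y := by
  induction n with
  | zero => intro m z t X Y; simp [G]
  | succ n ih =>
    intro m z t X Y
    rw [G, G, ih, show t * X - z * (t * Y) = t * (X - z * Y) by ring, mul_pow]
    ring

lemma G_poly (F : ℕ → ℂ → ℂ) (n : ℕ) : ∀ (m : ℕ) (z a b c d : ℂ),
    ∃ Q : Polynomial ℂ, ∀ X, G F n m z (a * X + b) (c * X + d) = Q.eval X := by
  induction n with
  | zero => intro m z a b c d; exact ⟨Polynomial.C (F (m+1) z), fun X => by simp [G]⟩
  | succ n ih =>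
    intro m z a b c d
    obtain ⟨Q, hQ⟩ := ih (m+1) z a b c d
    refine ⟨(Polynomial.C a * Polynomial.X + Polynomial.C b - Polynomial.C z *
      (Polynomial.C c * Polynomial.X + Polynomial.C d)) ^ (n+1) * Polynomial.C (F (m+1) z)
      + Polynomial.C ((n:ℂ)+1) * (Polynomial.C c * Polynomial.X + Polynomial.C d) * Q, fun X => ?_⟩
    rw [G, hQ]
    simp

lemma P_zero {F : ℕ → ℂ → ℂ} {n : ℕ} {M : Mat} (h : ∀ X : ℚ, P F n M X 1 = 0) (X : ℂ) : P F n M X 1 = 0 := by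
  obtain ⟨Q1, h1⟩ := G_poly F n 0 (mob M Complex.I) (M 0 0) (M 0 1) (M 1 0) (M 1 1)
  obtain ⟨Q2, h2⟩ := G_poly F n 0 Complex.I 1 0 0 1
  have e : ∀ X, P F n M X 1 = (Q1 - Q2).eval X := by
    intro X
    rw [P, GM, Polynomial.eval_sub, ← h1, ← h2]
    simp
  have : Q1 - Q2 = 0 := by
    apply Polynomial.eq_zero_of_infinite_isRoot
    refine Set.Infinite.mono ?_ (Set.infinite_range_of_injective (Rat.cast_injective (α := ℂ)))
    rintro _ ⟨q, rfl⟩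
    simp only [Set.mem_ofPred_eq, Polynomial.IsRoot.def]
    rw [← e, h]
  rw [e, this]; simp

lemma phi_mod {F : ℕ → ℂ → ℂ} {n N : ℕ} (hF : ∀ m z, 0 < z.im → HasDerivAt (F (m+1)) (F m z) z)
    (hmod : ∀ M, Gam N M → ∀ z : ℂ, 0 < z.im → F 0 (mob M z) = den M z ^ (n + 2) * F 0 z)
    (h0 : ∀ M, Gam N M → ∀ X : ℚ, P F n M X 1 = 0) {M : Mat} (hM : Gam N M) {z : ℂ} (hz : 0 < z.im) :
    den M z ^ n * F (n+1) (mob M z) = F (n+1) z := by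
  have hM0 : 0 < M.det := by rw [hM.1]; norm_num
  have hd := den_ne hM0 hz
  have h := P_eq hF hmod hM hz z 1
  rw [P_zero (h0 M hM), add_zero, G_diag, GM] at h
  have e1 : (M 0 0 : ℂ) * z + M 0 1 * 1 = den M z * mob M z := by
    rw [mob]; field_simp
  have e2 : (M 1 0 : ℂ) * z + M 1 1 * 1 = den M z * 1 := by rw [den]; ring
  rw [e1, e2, G_homog, G_diag] at h
  have hf : (n.factorial : ℂ) ≠ 0 := by exact_mod_cast n.factorial_ne_zero
  simp only [zero_add] at h
  apply mul_left_cancel₀ hf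
  linear_combination h

open UpperHalfPlane Manifold in
lemma mdiff_of {Ψ : ℂ → ℂ} (hd : ∀ z : ℂ, 0 < z.im → DifferentiableAt ℂ Ψ z) :
    MDiff (fun τ : UpperHalfPlane => Ψ τ) := by
  rw [UpperHalfPlane.mdifferentiable_iff]
  intro z hz
  refine ((hd z hz).differentiableWithinAt).congr (fun w hw => ?_) ?_
  · simp [UpperHalfPlane.ofComplex_apply_of_im_pos hw]
  · simp [UpperHalfPlane.ofComplex_apply_of_im_pos hz]

open UpperHalfPlane Manifold in
lemma bdd_of {Ψ : ℂ → ℂ} {N : ℝ} (hN : 0 < N) (hd : ∀ z : ℂ, 0 < z.im → DifferentiableAt ℂ Ψ z)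
    (hper : ∀ z : ℂ, 0 < z.im → Ψ (z + N) = Ψ z) {C : ℝ} {K : ℕ}
    (hb : ∀ z : ℂ, 1 ≤ z.im → ‖Ψ z‖ ≤ C * z.im ^ K) :
    IsBoundedAtImInfty (fun τ : UpperHalfPlane => Ψ τ) := by
  have hNC : (N : ℂ) ≠ 0 := by exact_mod_cast hN.ne'
  set Q : ℂ → ℂ := fun z => Complex.exp (2 * π * Complex.I * z / N) with hQ
  have hQn : ∀ z, ‖Q z‖ = Real.exp (-2 * π * z.im / N) := by
    intro z
    rw [hQ]
    simp only
    rw [Complex.norm_exp]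
    congr 1
    rw [Complex.div_ofReal_re]
    simp
  have hQper : ∀ z, Q (z + N) = Q z := by
    intro z
    simp only [hQ]
    rw [show (2 * π * Complex.I * (z + N) / N : ℂ) = 2 * π * Complex.I * z / N + 2 * π * Complex.I by field_simp,
      Complex.exp_periodic]
  have hQd : ∀ z, DifferentiableAt ℂ Q z := by intro z; fun_prop
  have hm := mdiff_of (Ψ := fun z => Ψ z * Q z) (fun z hz => (hd z hz).mul (hQd z))
  have hz : IsZeroAtImInfty (fun τ : UpperHalfPlane => Ψ τ * Q τ) := by
    have hlim : Filter.Tendsto (fun y : ℝ => C * (y ^ K * Real.exp (-(2 * π / N) * y))) Filter.atTop (nhds 0) := by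
      have := tendsto_rpow_mul_exp_neg_mul_atTop_nhds_zero K (2 * π / N) (by positivity)
      simp only [Real.rpow_natCast] at this
      simpa using this.const_mul C
    have hlim2 : Filter.Tendsto (fun τ : UpperHalfPlane => C * (τ.im ^ K * Real.exp (-(2 * π / N) * τ.im)))
        atImInfty (nhds 0) := hlim.comp Filter.tendsto_comap
    refine squeeze_zero_norm' ?_ hlim2
    have : ∀ᶠ τ in atImInfty, 1 ≤ UpperHalfPlane.im τ := Filter.tendsto_comap.eventually (Filter.eventually_ge_atTop 1)
    filter_upwards [this] with τ hτ
    rw [norm_mul, hQn]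
    have h1 := hb τ (by simpa using hτ)
    calc _ ≤ (C * (τ:ℂ).im ^ K) * Real.exp (-2 * π * (τ:ℂ).im / N) := by gcongr
      _ = _ := by
        rw [UpperHalfPlane.coe_im, mul_assoc]
        congr 3
        ring
  have hp : Function.Periodic ((fun τ : UpperHalfPlane => Ψ τ * Q τ) ∘ ofComplex) (N : ℂ) := by
    intro z
    by_cases h : 0 < z.im
    · have h' : 0 < (z + N).im := by simpa using h
      simp [UpperHalfPlane.ofComplex_apply_of_im_pos h, UpperHalfPlane.ofComplex_apply_of_im_pos h', hper z h, hQper]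
    · have h' : (z + N).im ≤ 0 := by simpa using h
      simp [UpperHalfPlane.ofComplex_apply_of_im_nonpos (not_lt.1 h), UpperHalfPlane.ofComplex_apply_of_im_nonpos h']
  have hO := hz.exp_decay_atImInfty hN hp hm hz.isBoundedAtImInfty
  obtain ⟨c, hc⟩ := hO.bound
  rw [IsBoundedAtImInfty, Filter.BoundedAtFilter]
  refine Asymptotics.IsBigO.of_bound c ?_
  filter_upwards [hc] with τ hτ
  rw [norm_mul, hQn, UpperHalfPlane.coe_im, Real.norm_eq_abs, abs_of_pos (Real.exp_pos _)] at hτ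
  simpa using le_of_mul_le_mul_right hτ (Real.exp_pos _)


/-- conjugate of a translation -/
def conj (N : ℕ) (g : Mat) : Mat :=
  !![1 - N * g 0 0 * g 1 0, N * g 0 0 ^ 2; - N * g 1 0 ^ 2, 1 + N * g 0 0 * g 1 0]

/-- translation -/
def tr (N : ℕ) : Mat := !![1, N; 0, 1]

lemma conj_gam (N : ℕ) (g : Mat) : Gam N (conj N g) := by
  refine ⟨?_, ?_⟩
  · rw [Matrix.det_fin_two]; simp [conj]; ring
  · simp [conj]

lemma conj_mul (N : ℕ) {g : Mat} (hg : g.det = 1) : conj N g * g = g * tr N := by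
  rw [Matrix.det_fin_two] at hg
  ext i j
  fin_cases i <;> fin_cases j <;> simp [conj, tr, Matrix.mul_apply, Fin.sum_univ_two]
  · ring
  · linear_combination (N * g 0 0 : ℤ) * hg
  · ring
  · linear_combination (N * g 1 0 : ℤ) * hg

section
variable {φ : ℂ → ℂ} {n N B : ℕ}

lemma slash_per (hφ : ∀ M, Gam N M → ∀ z : ℂ, 0 < z.im → den M z ^ n * φ (mob M z) = φ z)
    {g : Mat} (hg : g.det = 1) {z : ℂ} (hz : 0 < z.im) :
    den g (z + N) ^ n * φ (mob g (z + N)) = den g z ^ n * φ (mob g z) := by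
  have hg0 : 0 < g.det := by rw [hg]; norm_num
  have d1 : den (tr N) z = 1 := by simp [den, tr]
  have m1 : mob (tr N) z = z + N := by rw [mob, d1]; simp [tr]
  have h1 : den (tr N) z ≠ 0 := by rw [d1]; exact one_ne_zero
  have h2 := den_ne hg0 hz
  rw [← m1, ← mob_mul h1, show den g (mob (tr N) z) = den (g * tr N) z by rw [den_mul h1, d1, mul_one],
    ← conj_mul N hg, mob_mul h2, den_mul h2, mul_pow, mul_right_comm, hφ _ (conj_gam N g) _ (mob_im hg0 hz)]
  ring

lemma slash_growth (hN : 0 < N) {D : ℝ} (hD : 0 ≤ D) (hb : ∀ z : ℂ, 0 < z.im → ‖φ z‖ ≤ D / z.im ^ B)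
    (hφ : ∀ M, Gam N M → ∀ z : ℂ, 0 < z.im → den M z ^ n * φ (mob M z) = φ z)
    {g : Mat} (hg : g.det = 1) : ∃ (C : ℝ) (K : ℕ), ∀ z : ℂ, 1 ≤ z.im →
      ‖den g z ^ n * φ (mob g z)‖ ≤ C * z.im ^ K := by
  have hg0 : 0 < g.det := by rw [hg]; norm_num
  set R : ℝ := |(g 1 0 : ℝ)| * (N + 1) + |(g 1 1 : ℝ)| with hR
  have hR0 : 0 ≤ R := by positivity
  -- reduced region
  have key : ∀ z : ℂ, 1 ≤ z.im → 0 ≤ z.re → z.re ≤ N →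
      ‖den g z ^ n * φ (mob g z)‖ ≤ D * R ^ (n + 2 * B) * z.im ^ (n + B) := by
    intro z hz h0 h1
    have hz0 : 0 < z.im := by linarith
    have hd := den_ne hg0 hz0
    have hdn : 0 < ‖den g z‖ := norm_pos_iff.2 hd
    have him : (mob g z).im = z.im / ‖den g z‖ ^ 2 := by
      rw [mob, Complex.div_im, ← Complex.normSq_eq_norm_sq]
      rw [Matrix.det_fin_two] at hg
      have : ((g 0 0 : ℝ) * g 1 1 - g 0 1 * g 1 0) = 1 := by exact_mod_cast hg
      simp only [den]
      simp
      rw [← sub_div]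
      congr 1
      linear_combination z.im * this
    have hden : ‖den g z‖ ≤ R * z.im := by
      have hzn : ‖z‖ ≤ (N + 1) * z.im := by
        calc ‖z‖ ≤ |z.re| + |z.im| := Complex.norm_le_abs_re_add_abs_im z
          _ ≤ N + z.im := by rw [abs_of_nonneg h0, abs_of_pos hz0]; linarith
          _ ≤ _ := by
            have : (0:ℝ) ≤ N := Nat.cast_nonneg N
            nlinarith
      calc ‖den g z‖ ≤ ‖(g 1 0 : ℂ) * z‖ + ‖(g 1 1 : ℂ)‖ := norm_add_le _ _
        _ = |(g 1 0 : ℝ)| * ‖z‖ + |(g 1 1 : ℝ)| := by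
          rw [norm_mul, Complex.norm_intCast, Complex.norm_intCast]
        _ ≤ |(g 1 0 : ℝ)| * ((N + 1) * z.im) + |(g 1 1 : ℝ)| * z.im := by
          gcongr
          exact le_mul_of_one_le_right (abs_nonneg _) hz
        _ = R * z.im := by rw [hR]; ring
    have hφb := hb _ (mob_im hg0 hz0)
    rw [him] at hφb
    rw [norm_mul, norm_pow]
    calc _ ≤ ‖den g z‖ ^ n * (D / (z.im / ‖den g z‖ ^ 2) ^ B) := by gcongr
      _ = D * ‖den g z‖ ^ (n + 2 * B) / z.im ^ B := by
        rw [div_pow, ← pow_mul, pow_add]; field_simp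
      _ ≤ D * (R * z.im) ^ (n + 2 * B) / z.im ^ B := by gcongr
      _ = _ := by
        rw [mul_pow]
        field_simp
        ring
  have hper : ∀ z : ℂ, 0 < z.im → ∀ m : ℕ, den g (z + m * N) ^ n * φ (mob g (z + m * N)) =
      den g z ^ n * φ (mob g z) := by
    intro z hz m
    induction m with
    | zero => simp
    | succ m ih =>
      rw [← ih, ← slash_per hφ hg (z := z + m * N) (by simpa using hz)]
      congr 3 <;> push_cast <;> ring
  have hNR : (0:ℝ) < N := by exact_mod_cast hN
  refine ⟨D * R ^ (n + 2 * B), n + B, fun z hz => ?_⟩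
  have hz0 : 0 < z.im := by linarith
  -- move to the region
  set j : ℤ := ⌊z.re / N⌋ with hj
  set w : ℂ := z - j * N with hw
  have hwi : w.im = z.im := by simp [hw]
  have hwr : w.re = z.re - j * N := by simp [hw]
  have f1 := Int.floor_le (z.re / N)
  have f2 := Int.lt_floor_add_one (z.re / N)
  rw [← hj] at f1 f2
  rw [le_div_iff₀ hNR] at f1
  rw [div_lt_iff₀ hNR] at f2
  have e : den g z ^ n * φ (mob g z) = den g w ^ n * φ (mob g w) := by
    rcases Int.eq_nat_or_neg j with ⟨m, hm | hm⟩
    · rw [← hper w (by rw [hwi]; exact hz0) m]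
      congr 3 <;> rw [hw, hm] <;> push_cast <;> ring
    · rw [← hper z hz0 m]
      congr 3 <;> rw [hw, hm] <;> push_cast <;> ring
  rw [e, ← hwi]
  exact key w (by rw [hwi]; exact hz) (by rw [hwr]; linarith) (by rw [hwr]; nlinarith)

lemma slash_diff (hd : ∀ z : ℂ, 0 < z.im → DifferentiableAt ℂ φ z) {g : Mat} (hg : g.det = 1) :
    ∀ z : ℂ, 0 < z.im → DifferentiableAt ℂ (fun z => den g z ^ n * φ (mob g z)) z := by
  intro z hz
  have hg0 : 0 < g.det := by rw [hg]; norm_num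
  have h1 : DifferentiableAt ℂ (den g) z := by unfold den; fun_prop
  exact (h1.pow n).mul ((hd _ (mob_im hg0 hz)).comp z (mob_hasDerivAt hg0 hz).differentiableAt)

lemma slash_eq (g : Matrix.SpecialLinearGroup (Fin 2) ℤ) :
    SlashAction.map (-(n:ℤ)) g (fun τ : UpperHalfPlane => φ τ) =
      fun τ : UpperHalfPlane => den (g : Mat) τ ^ n * φ (mob (g : Mat) τ) := by
  funext τ
  rw [ModularForm.SL_slash_apply, smul_mob, denom_den, neg_neg, zpow_natCast, mul_comm]

lemma exists_form (hN : 0 < N) (hd : ∀ z : ℂ, 0 < z.im → DifferentiableAt ℂ φ z) {D : ℝ} (hD : 0 ≤ D)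
    (hb : ∀ z : ℂ, 0 < z.im → ‖φ z‖ ≤ D / z.im ^ B)
    (hφ : ∀ M, Gam N M → ∀ z : ℂ, 0 < z.im → den M z ^ n * φ (mob M z) = φ z) :
    ∃ h : ModularForm (CongruenceSubgroup.Gamma0 N) (-(n:ℤ)), ∀ τ, h τ = φ τ := by
  have : NeZero N := ⟨hN.ne'⟩
  refine ⟨{ toFun := fun τ => φ τ, slash_action_eq' := ?_, holo' := mdiff_of hd, bdd_at_cusps' := ?_ }, fun τ => rfl⟩
  · rintro _ ⟨g, hg, rfl⟩
    have h1 := slash_eq (φ := φ) (n := n) g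
    rw [ModularForm.SL_slash] at h1
    refine h1.trans ?_
    funext τ
    exact hφ _ ((gam_iff g).2 hg) _ τ.2
  · intro c hc
    rw [Subgroup.IsArithmetic.isCusp_iff_isCusp_SL2Z] at hc
    rw [OnePoint.isBoundedAt_iff_forall_SL2Z hc]
    intro g _
    rw [slash_eq]
    obtain ⟨C, K, hCK⟩ := slash_growth hN hD hb hφ g.2
    exact bdd_of (Ψ := fun z => den (g : Mat) z ^ n * φ (mob (g : Mat) z)) (N := N) (by exact_mod_cast hN)
      (slash_diff hd g.2) (fun z hz => by simpa using slash_per hφ g.2 hz) hCK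

lemma phi_zero (hN : 0 < N) (hd : ∀ z : ℂ, 0 < z.im → DifferentiableAt ℂ φ z) {D : ℝ} (hD : 0 ≤ D)
    (hB : 0 < B) (hb : ∀ z : ℂ, 0 < z.im → ‖φ z‖ ≤ D / z.im ^ B)
    (hφ : ∀ M, Gam N M → ∀ z : ℂ, 0 < z.im → den M z ^ n * φ (mob M z) = φ z) :
    ∀ z : ℂ, 0 < z.im → φ z = 0 := by
  have : NeZero N := ⟨hN.ne'⟩
  obtain ⟨h, hh⟩ := exists_form hN hd hD hb hφ
  intro z hz
  rcases Nat.eq_zero_or_pos n with rfl | hn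
  · obtain ⟨c, hc⟩ := ModularForm.eq_const_of_weight_zero (𝒢 := (CongruenceSubgroup.Gamma0 N : Subgroup (Matrix.SpecialLinearGroup (Fin 2) ℤ)).map (Matrix.SpecialLinearGroup.mapGL ℝ)) h
    have hc' : ∀ z : ℂ, 0 < z.im → φ z = c := fun z hz => by
      rw [show z = ((⟨z, hz⟩ : UpperHalfPlane) : ℂ) from rfl, ← hh, hc]; rfl
    rw [hc' z hz]
    have hlim : Filter.Tendsto (fun t : ℝ => D / t ^ B) Filter.atTop (nhds 0) :=
      Filter.Tendsto.const_div_atTop (Filter.tendsto_pow_atTop hB.ne') D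
    have : ‖c‖ ≤ 0 := by
      refine ge_of_tendsto hlim ?_
      filter_upwards [Filter.eventually_gt_atTop 0] with t ht
      have h1 := hb (t * Complex.I) (by simpa using ht)
      rw [hc' _ (by simpa using ht)] at h1
      simpa using h1
    simpa using this
  · have h0 : h = 0 := ModularForm.isZero_of_neg_weight (by omega) h
    have := hh ⟨z, hz⟩
    rw [h0] at this
    simpa using this.symm

end

lemma tower_zero {F : ℕ → ℂ → ℂ} (hF : ∀ m z, 0 < z.im → HasDerivAt (F (m+1)) (F m z) z) (m : ℕ)
    (h : ∀ z : ℂ, 0 < z.im → F m z = 0) : ∀ z : ℂ, 0 < z.im → F 0 z = 0 := by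
  induction m with
  | zero => exact h
  | succ m ih =>
    refine ih fun z hz => ?_
    have ho : IsOpen {z : ℂ | 0 < z.im} := isOpen_lt continuous_const Complex.continuous_im
    have h1 : F (m+1) =ᶠ[nhds z] fun _ => 0 := by
      filter_upwards [ho.mem_nhds hz] with w hw using h w hw
    exact (hF m z hz).unique ((hasDerivAt_const z (0:ℂ)).congr_of_eventuallyEq h1)

lemma L_ne (f : PrimitiveForm) : ∃ l ∈ L (FF f) (f.weight - 2) f.level, l ≠ 0 := by
  by_contra! hcon
  have h0 : ∀ M, Gam f.level M → ∀ X : ℚ, P (FF f) (f.weight - 2) M X 1 = 0 := by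
    intro M hM X
    refine hcon _ (Submodule.subset_span ⟨M, X, 1, hM, ?_⟩)
    simp
  obtain ⟨D, hD, hb⟩ := FF_bound f (f.weight - 2 + 1)
  have hz := phi_zero (Nat.pos_of_ne_zero (level_ne f)) (fun z hz => (FF_deriv f _ z hz).differentiableAt) hD
    (by omega) hb (fun M hM z hz => phi_mod (FF_deriv f) (FF_mod f) h0 hM hz)
  have hz0 := tower_zero (FF_deriv f) _ hz
  have hform : f.form = 0 := by
    ext τ
    rw [← FF_zero, hz0 _ τ.2]; rfl
  have h1 := coeff_eq f 1
  rw [hform, f.coeff_one] at h1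
  have h2 := ModularFormClass.qExpansion_coeff_unique (c := fun m => (0 : ℂ)) one_pos (one_mem_per f.level)
    (f := (0 : CuspForm (CongruenceSubgroup.Gamma0 f.level) f.weight)) (fun τ => by simp [hasSum_zero]) 1
  rw [← h2] at h1
  simp at h1

end LT

open scoped Real
namespace LT

lemma lambda_sq (f : PrimitiveForm) {p : ℕ} (hp : p.Prime) :
    f.lambda p ^ 2 = f.coeff p ^ 2 / (p : ℝ) ^ (f.weight - 1) := by
  have h1 := f.weight_pos
  have hp0 : (0:ℝ) ≤ p := Nat.cast_nonneg p
  rw [PrimitiveForm.lambda, div_pow, ← Real.rpow_mul_natCast hp0]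
  have e : (((f.weight - 1 : ℕ)) : ℝ) = ((f.weight : ℝ) - 1) / 2 * (2 : ℕ) := by
    rw [Nat.cast_sub h1]; push_cast; ring
  rw [← e, Real.rpow_natCast]

lemma lambda_cos (f : PrimitiveForm) {p : ℕ} (hp : p.Prime) :
    f.lambda p = 2 * Real.cos (f.theta p) := by
  have hp0 : (0:ℝ) < p := by exact_mod_cast hp.pos
  have hq : (0:ℝ) < (p : ℝ) ^ (((f.weight : ℝ) - 1) / 2) := Real.rpow_pos_of_pos hp0 _
  have h : |f.lambda p| ≤ 2 := by
    rw [PrimitiveForm.lambda, abs_div, abs_of_pos hq, div_le_iff₀ hq]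
    exact f.deligne p hp
  rw [abs_le] at h
  rw [PrimitiveForm.theta, Real.cos_arccos (by linarith) (by linarith)]
  ring

end LT

theorem lambda_theta_irrational (f : PrimitiveForm) :
    {p : ℕ | p.Prime ∧
      ¬(f.lambda p = 0 ∨ f.lambda p = 2 ∨ f.lambda p = -2 ∨
        Irrational (f.theta p / Real.pi))}.Finite := by
  have : NeZero f.level := ⟨LT.level_ne f⟩
  have := LT.L_fd (n := f.weight - 2) (N := f.level) (LT.FF_deriv f) (LT.FF_mod f)
  obtain ⟨l, hl, hl0⟩ := LT.L_ne f
  obtain ⟨K, hK, hKm⟩ := LT.exists_field _ l hl hl0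
  refine ((f.level.divisors.finite_toSet).union (LT.arith K)).subset ?_
  rintro p ⟨hp, hn⟩
  push Not at hn
  obtain ⟨h0, -, -, hirr⟩ := hn
  by_cases hpN : p ∣ f.level
  · left
    simpa using ⟨hpN, LT.level_ne f⟩
  right
  have ha : (f.coeff p : ℂ) ∈ K := hKm _ (LT.LL_hecke f hp hpN)
  have hpK : ∀ m : ℕ, ((p : ℂ) ^ m) ∈ K := fun m => pow_mem (natCast_mem K p) m
  have hpC : (p : ℂ) ≠ 0 := by exact_mod_cast hp.ne_zero
  have hsq : ((f.lambda p ^ 2 : ℝ) : ℂ) = (f.coeff p : ℂ) ^ 2 / (p : ℂ) ^ (f.weight - 1) := by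
    rw [LT.lambda_sq f hp]; push_cast; rfl
  have hy : ((f.lambda p ^ 2 : ℝ) : ℂ) ∈ K := by
    rw [hsq]; exact div_mem (pow_mem ha 2) (hpK _)
  obtain ⟨r, hr⟩ := f.weight_even
  have hw0 := f.weight_pos
  obtain ⟨s, rfl⟩ : ∃ s, r = s + 1 := ⟨r - 1, by omega⟩
  refine ⟨hp, ⟨_, hy⟩, ?_, ⟨⟨(f.coeff p : ℂ) / (p : ℂ) ^ s, div_mem ha (hpK s)⟩, ?_⟩, ?_⟩
  · intro h
    have := congrArg Subtype.val h
    simp at this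
    exact h0 this
  · apply Subtype.ext
    push_cast
    have : f.weight - 1 = 2 * s + 1 := by omega
    have hsq2 := hsq
    rw [this] at hsq2
    push_cast at hsq2
    rw [hsq2]
    field_simp
    try ring
  · rw [Irrational, not_not] at hirr
    obtain ⟨q, hq⟩ := hirr
    have hθ : f.theta p = q * π := by
      rw [hq]; field_simp
    refine ⟨Complex.exp (2 * π * Complex.I * q), q.den, q.den_pos, ?_, ?_⟩
    · rw [← Complex.exp_nat_mul, Complex.exp_eq_one_iff]
      refine ⟨q.num, ?_⟩
      have : (q : ℂ) * q.den = q.num := by exact_mod_cast Rat.mul_den_eq_num q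
      linear_combination (2 * π * Complex.I) * this
    · change ((f.lambda p ^ 2 : ℝ) : ℂ) = _
      rw [LT.lambda_cos f hp, hθ]
      push_cast
      rw [Complex.cos, ← Complex.exp_neg]
      have e1 : Complex.exp (2 * π * Complex.I * q) = Complex.exp (q * π * Complex.I) ^ 2 := by
        rw [← Complex.exp_nat_mul]; congr 1; push_cast; ring
      have e2 : Complex.exp (-(2 * π * Complex.I * q)) = Complex.exp (-(q * π) * Complex.I) ^ 2 := by
        rw [← Complex.exp_nat_mul]; congr 1; push_cast; ring
      have e3 : Complex.exp (q * π * Complex.I) * Complex.exp (-(q * π) * Complex.I) = 1 := by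
        rw [← Complex.exp_add, ← Complex.exp_zero]; congr 1; ring
      rw [e1, e2]
      linear_combination 2 * e3
end

section
/- Let Σ be a finite set of primes, a₁,…,a_k,b₁,…,b_k integers with a_i ≠ 0, gcd(a_i,b_i)=1 for each i and a_i b_j − a_j b_i ≠ 0 for i ≠ j, such that (2k)! · ∏_{i=1}^k a_i · ∏_{1≤i<j≤k}(a_i b_j − a_j b_i) is a Σ-unit. Write a = a_k, b = b_k, L(n) = L_k(n) = an + b, M = max{|a|,|b|}, and assume every prime of Σ divides a. Then there exist C₃ ≥ 2 depending only on k, and z₃ ≥ 2 depending on k and M, such that for every prime p ∉ Σ and all x, z with x ≥ z ≥ z₃, the set Ω₁(x,z) has at most C₃ · 2^{#Σ} · (x/p) · (log z)^{−k} elements n with p | L(n). -/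
/-- An integer is a `Σ`-unit if all its prime divisors belong to `Σ`. -/
def IsSigmaUnit (S : Finset ℕ) (n : ℤ) : Prop :=
  ∀ p : ℕ, p.Prime → (p : ℤ) ∣ n → p ∈ S

/-- An integer is `Σ`-square-free if it is a product of a `Σ`-unit and a square-free integer. -/
def IsSigmaSquarefree (S : Finset ℕ) (n : ℤ) : Prop :=
  ∃ u v : ℤ, IsSigmaUnit S u ∧ Squarefree v ∧ n = u * v

/-- An integer is composite if it is a product of two integers both `> 1`. -/
def IsComposite (n : ℤ) : Prop :=
  ∃ a b : ℤ, 1 < a ∧ 1 < b ∧ n = a * b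

open Classical in
/-- `P_Σ(z) = ∏_{p < z, p ∉ Σ} p`, the product of primes below `z` not in `Σ`. -/
noncomputable def sievePSigma (S : Finset ℕ) (z : ℝ) : ℕ :=
  ∏ p ∈ Finset.filter (fun p : ℕ => Nat.Prime p ∧ (p : ℝ) < z ∧ p ∉ S)
      (Finset.range (Nat.ceil z + 1)), p

/-- `Ω(x,z)`: the set of positive integers `n ≤ x` such that the product
`L₁(n)⋯L_k(n)` of the linear forms `L_i(n) = a_i n + b_i` is coprime to `P_Σ(z)`. -/
noncomputable def sieveOmega {k : ℕ} (S : Finset ℕ) (a b : Fin k → ℤ) (x z : ℝ) : Set ℕ :=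
  {n : ℕ | 1 ≤ n ∧ (n : ℝ) ≤ x ∧
    Int.gcd (∏ i, (a i * n + b i)) (sievePSigma S z) = 1}

/-- `Ω₁(x,z)`: the subset of `Ω(x,z)` of those `n` for which each `L_i(n)` is a
`Σ`-square-free composite number. -/
noncomputable def sieveOmega1 {k : ℕ} (S : Finset ℕ) (a b : Fin k → ℤ) (x z : ℝ) : Set ℕ :=
  {n ∈ sieveOmega S a b x z |
    ∀ i, IsSigmaSquarefree S (a i * n + b i) ∧ IsComposite (a i * n + b i)}

/-- The non-degeneracy and `Σ`-unit hypotheses on the linear forms `L_i(n) = a_i n + b_i`: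
`a_i ≠ 0`, `gcd(a_i, b_i) = 1`, `a_i b_j - a_j b_i ≠ 0` for `i ≠ j`, and
`(2k)!·∏_i a_i·∏_{i<j} (a_i b_j - a_j b_i)` is a `Σ`-unit. -/
def SieveHypotheses {k : ℕ} (S : Finset ℕ) (a b : Fin k → ℤ) : Prop :=
  (∀ i, a i ≠ 0) ∧
  (∀ i, Int.gcd (a i) (b i) = 1) ∧
  (∀ i j, i ≠ j → a i * b j - a j * b i ≠ 0) ∧
  IsSigmaUnit S
    (((2 * k).factorial : ℤ) * (∏ i, a i) *
      ∏ q ∈ Finset.univ.filter (fun q : Fin k × Fin k => q.1 < q.2),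
        (a q.1 * b q.2 - a q.2 * b q.1))


lemma ssp_sum_mul_period (g : ℕ → ℝ) (m : ℕ) (hg : Function.Periodic g m) (c : ℕ) :
    ∑ t ∈ Finset.range (m * c), g t = c * ∑ t ∈ Finset.range m, g t := by
  induction c with
  | zero => simp
  | succ c ih =>
    rw [Nat.mul_succ, Finset.sum_range_add, ih]
    have : ∀ x ∈ Finset.range m, g (m * c + x) = g x := by
      intro x _
      have := hg.nat_mul c x
      rw [← this]
      congr 1
      simp; ring
    rw [Finset.sum_congr rfl this]
    push_cast; ring

lemma ssp_crt (m n : ℕ) (hm : 0 < m) (hn : 0 < n) (co : Nat.Coprime m n) (g g' : ℕ → ℝ)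
    (hg : Function.Periodic g m) (hg' : Function.Periodic g' n) :
    ∑ t ∈ Finset.range (m * n), g t * g' t =
      (∑ t ∈ Finset.range m, g t) * ∑ t ∈ Finset.range n, g' t := by
  rw [Finset.sum_mul_sum, ← Finset.sum_product']
  refine Finset.sum_bij' (fun t _ => (t % m, t % n))
    (fun ab _ => (Nat.chineseRemainder co ab.1 ab.2 : ℕ)) ?_ ?_ ?_ ?_ ?_
  · intro t _
    simp [Nat.mod_lt _ hm, Nat.mod_lt _ hn]
  · intro ab _
    simp only [Finset.mem_range]
    exact Nat.chineseRemainder_lt_mul co _ _ hm.ne' hn.ne'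
  · intro t ht
    simp only [Finset.mem_range] at ht
    have h := (Nat.chineseRemainder co (t % m) (t % n)).2
    have h1 : (Nat.chineseRemainder co (t % m) (t % n) : ℕ) ≡ t [MOD m] := 
      h.1.trans (Nat.mod_modEq _ _)
    have h2 : (Nat.chineseRemainder co (t % m) (t % n) : ℕ) ≡ t [MOD n] := 
      h.2.trans (Nat.mod_modEq _ _)
    have h3 := (Nat.modEq_and_modEq_iff_modEq_mul co).1 ⟨h1, h2⟩
    have h4 := Nat.chineseRemainder_lt_mul co (t % m) (t % n) hm.ne' hn.ne'
    exact Nat.ModEq.eq_of_lt_of_lt h3 h4 ht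
  · rintro ⟨a, b⟩ hab
    simp only [Finset.mem_product, Finset.mem_range] at hab
    have h := (Nat.chineseRemainder co a b).2
    simp only
    ext
    · simpa [Nat.ModEq, Nat.mod_eq_of_lt hab.1] using h.1
    · simpa [Nat.ModEq, Nat.mod_eq_of_lt hab.2] using h.2
  · intro t _
    simp only
    rw [hg.map_mod_nat, hg'.map_mod_nat]

lemma ssp_prod_periodic (T : Finset ℕ) (g : ℕ → ℕ → ℝ)
    (hg : ∀ q ∈ T, Function.Periodic (g q) q) :
    Function.Periodic (fun t => ∏ q ∈ T, g q t) (∏ q ∈ T, q) := by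
  intro t
  refine Finset.prod_congr rfl fun q hq => ?_
  obtain ⟨c, hc⟩ := Finset.dvd_prod_of_mem (fun q : ℕ => q) hq
  rw [hc]
  have := (hg q hq).nat_mul c t
  rw [← this]
  congr 1
  simp; ring

lemma ssp_prod_crt (T : Finset ℕ) (hT : ∀ q ∈ T, q.Prime) (g : ℕ → ℕ → ℝ)
    (hg : ∀ q ∈ T, Function.Periodic (g q) q) :
    ∑ t ∈ Finset.range (∏ q ∈ T, q), ∏ q ∈ T, g q t = ∏ q ∈ T, ∑ t ∈ Finset.range q, g q t := by
  induction T using Finset.induction_on with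
  | empty => simp
  | insert p T hp ih =>
    have hT' : ∀ q ∈ T, q.Prime := fun q hq => hT q (Finset.mem_insert_of_mem hq)
    have hg' : ∀ q ∈ T, Function.Periodic (g q) q := fun q hq => hg q (Finset.mem_insert_of_mem hq)
    have hpp := hT p (Finset.mem_insert_self _ _)
    simp only [Finset.prod_insert hp]
    rw [← ih hT' hg']
    refine ssp_crt _ _ hpp.pos (Finset.prod_pos fun q hq => (hT' q hq).pos) ?_ _ _
      (hg p (Finset.mem_insert_self _ _)) (ssp_prod_periodic T g hg')
    refine Nat.Coprime.prod_right fun q hq => ?_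
    rw [Nat.coprime_primes hpp (hT' q hq)]
    rintro rfl; exact hp hq

/-- correlation bound -/
lemma ssp_corr (f : ℕ → ℕ → ℝ) (h : ℕ → ℝ) (T₁ T₂ : Finset ℕ)
    (hP : ∀ q ∈ T₁ ∪ T₂, q.Prime) (hper : ∀ q ∈ T₁ ∪ T₂, Function.Periodic (f q) q)
    (hpos : ∀ q ∈ T₁ ∪ T₂, 0 < h q)
    (h0 : ∀ q ∈ T₁ ∪ T₂, ∑ t ∈ Finset.range q, f q t = 0)
    (h2 : ∀ q ∈ T₁ ∪ T₂, ∑ t ∈ Finset.range q, (f q t) ^ 2 = q / h q)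
    (hb : ∀ q ∈ T₁ ∪ T₂, ∀ t, |f q t| ≤ 1 / h q) (N D : ℕ)
    (hD₁ : ∏ q ∈ T₁, q ≤ D) (hD₂ : ∏ q ∈ T₂, q ≤ D) :
    (∏ q ∈ T₁, h q) * (∏ q ∈ T₂, h q) *
      ∑ t ∈ Finset.range N, (∏ q ∈ T₁, f q t) * (∏ q ∈ T₂, f q t) ≤
    (if T₁ = T₂ then N * ∏ q ∈ T₁, h q else 0) + (D : ℝ) ^ 2 := by
  classical
  have hH₁ : 0 < ∏ q ∈ T₁, h q := Finset.prod_pos fun q hq => hpos q (by simp [hq])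
  have hH₂ : 0 < ∏ q ∈ T₂, h q := Finset.prod_pos fun q hq => hpos q (by simp [hq])
  set U := T₁ ∪ T₂ with hU
  let g : ℕ → ℕ → ℝ := fun q t => (if q ∈ T₁ then f q t else 1) * (if q ∈ T₂ then f q t else 1)
  have hgper : ∀ q ∈ U, Function.Periodic (g q) q := by
    intro q hq t
    simp only [g, hper q hq t]
  have hfg : ∀ t, (∏ q ∈ T₁, f q t) * (∏ q ∈ T₂, f q t) = ∏ q ∈ U, g q t := by
    intro t
    simp only [g]
    rw [Finset.prod_mul_distrib, Finset.prod_ite_mem, Finset.prod_ite_mem]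
    rw [Finset.inter_eq_right.2 Finset.subset_union_left,
      Finset.inter_eq_right.2 Finset.subset_union_right]
  set m := ∏ q ∈ U, q with hm
  have hmpos : 0 < m := Finset.prod_pos fun q hq => (hP q hq).pos
  have hmD : m ≤ D * D := by
    calc m ≤ (∏ q ∈ T₁, q) * (∏ q ∈ T₂, q) := by
          rw [← Finset.prod_union_inter]
          refine Nat.le_mul_of_pos_right _ (Finset.prod_pos fun q hq => (hP q ?_).pos)
          simp at hq; simp [hU, hq]
      _ ≤ D * D := Nat.mul_le_mul hD₁ hD₂
  have hbd : ∀ t, (∏ q ∈ T₁, h q) * (∏ q ∈ T₂, h q) *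
      ((∏ q ∈ T₁, f q t) * (∏ q ∈ T₂, f q t)) ≤ 1 := by
    intro t
    have key : ∀ T : Finset ℕ, T ⊆ U → |(∏ q ∈ T, h q) * ∏ q ∈ T, f q t| ≤ 1 := by
      intro T hT
      rw [← Finset.prod_mul_distrib, Finset.abs_prod]
      refine Finset.prod_le_one (fun _ _ => abs_nonneg _) fun q hq => ?_
      rw [abs_mul, abs_of_pos (hpos q (hT hq))]
      have := hb q (hT hq) t
      calc h q * |f q t| ≤ h q * (1 / h q) := by
            gcongr; exact (hpos q (hT hq)).le
        _ = 1 := by field_simp [(hpos q (hT hq)).ne']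
    have k1 := key T₁ Finset.subset_union_left
    have k2 := key T₂ Finset.subset_union_right
    calc _ = ((∏ q ∈ T₁, h q) * ∏ q ∈ T₁, f q t) * ((∏ q ∈ T₂, h q) * ∏ q ∈ T₂, f q t) := by ring
      _ ≤ _ := le_abs_self _
      _ ≤ 1 := by rw [abs_mul]; exact mul_le_one₀ k1 (abs_nonneg _) k2
  have hsplit : ∑ t ∈ Finset.range N, (∏ q ∈ T₁, f q t) * (∏ q ∈ T₂, f q t) =
      (N / m : ℕ) * (∏ q ∈ U, ∑ t ∈ Finset.range q, g q t) +
      ∑ t ∈ Finset.range (N % m), 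
        (∏ q ∈ T₁, f q (m * (N / m) + t)) * (∏ q ∈ T₂, f q (m * (N / m) + t)) := by
    conv_lhs => rw [← Nat.div_add_mod N m]
    rw [Finset.sum_range_add]
    congr 1
    rw [← ssp_prod_crt U hP g hgper, ← ssp_sum_mul_period _ _ (ssp_prod_periodic U g hgper)]
    exact Finset.sum_congr rfl fun t _ => hfg t
  rw [hsplit, mul_add]
  refine add_le_add ?_ ?_
  · split_ifs with hTT
    · subst hTT
      have hU' : U = T₁ := by simp [hU]
      have : ∏ q ∈ U, ∑ t ∈ Finset.range q, g q t = m / ∏ q ∈ T₁, h q := by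
        rw [hm, Nat.cast_prod, hU', ← Finset.prod_div_distrib]
        refine Finset.prod_congr rfl fun q hq => ?_
        rw [← h2 q (by rw [hU']; exact hq)]
        refine Finset.sum_congr rfl fun t _ => ?_
        simp only [g, if_pos hq]; ring
      rw [this]
      have h3 : ((N / m : ℕ) : ℝ) * m ≤ N := by exact_mod_cast Nat.div_mul_le_self N m
      calc _ = (∏ q ∈ T₁, h q) * (((N / m : ℕ) : ℝ) * m) := by field_simp
        _ ≤ (∏ q ∈ T₁, h q) * N := by gcongr
        _ = _ := by ring
    · have : ∏ q ∈ U, ∑ t ∈ Finset.range q, g q t = 0 := by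
        have hex : ∃ q, ¬ (q ∈ T₁ ↔ q ∈ T₂) := by
          by_contra! hcon
          exact hTT (Finset.ext hcon)
        obtain ⟨q, hq⟩ := hex
        by_cases hq1 : q ∈ T₁
        · have hq2 : q ∉ T₂ := by tauto
          refine Finset.prod_eq_zero (i := q) (by simp [hU, hq1]) ?_
          simpa [g, hq1, hq2] using h0 q (by simp [hU, hq1])
        · have hq2 : q ∈ T₂ := by tauto
          refine Finset.prod_eq_zero (i := q) (by simp [hU, hq2]) ?_
          simpa [g, hq1, hq2] using h0 q (by simp [hU, hq2])
      rw [this]; simp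
  · rw [Finset.mul_sum]
    calc _ ≤ ∑ t ∈ Finset.range (N % m), (1:ℝ) := Finset.sum_le_sum fun t _ => hbd _
      _ = (N % m : ℕ) := by simp
      _ ≤ (m : ℕ) := by exact_mod_cast (Nat.mod_lt _ hmpos).le
      _ ≤ (D * D : ℕ) := by exact_mod_cast hmD
      _ = _ := by push_cast; ring

lemma ssp_selberg (f : ℕ → ℕ → ℝ) (h : ℕ → ℝ) (F : Finset (Finset ℕ)) (N D : ℕ)
    (hP : ∀ T ∈ F, ∀ q ∈ T, q.Prime) (hper : ∀ T ∈ F, ∀ q ∈ T, Function.Periodic (f q) q)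
    (hpos : ∀ T ∈ F, ∀ q ∈ T, 0 < h q)
    (h0 : ∀ T ∈ F, ∀ q ∈ T, ∑ t ∈ Finset.range q, f q t = 0)
    (h2 : ∀ T ∈ F, ∀ q ∈ T, ∑ t ∈ Finset.range q, (f q t) ^ 2 = q / h q)
    (hb : ∀ T ∈ F, ∀ q ∈ T, ∀ t, |f q t| ≤ 1 / h q)
    (hD : ∀ T ∈ F, ∏ q ∈ T, q ≤ D) (A : Finset ℕ) (hA : A ⊆ Finset.range N)
    (hA1 : ∀ T ∈ F, ∀ q ∈ T, ∀ t ∈ A, f q t = 1) (hJ : 1 ≤ ∑ T ∈ F, ∏ q ∈ T, h q) :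
    (A.card : ℝ) ≤ N / (∑ T ∈ F, ∏ q ∈ T, h q) + (D : ℝ) ^ 4 := by
  classical
  set J := ∑ T ∈ F, ∏ q ∈ T, h q with hJdef
  let W : ℕ → ℝ := fun t => ∑ T ∈ F, (∏ q ∈ T, h q) * ∏ q ∈ T, f q t
  have hW : ∀ t ∈ A, W t = J := by
    intro t ht
    refine Finset.sum_congr rfl fun T hT => ?_
    rw [Finset.prod_congr rfl (fun q hq => hA1 T hT q hq t ht)]
    simp
  have hcard : F.card ≤ D := by
    have : F.card ≤ (Finset.Icc 1 D).card := by
      refine Finset.card_le_card_of_injOn (fun T => ∏ q ∈ T, q) ?_ ?_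
      · intro T hT
        have := Finset.prod_pos fun q hq => (hP T hT q hq).pos
        simp only [Finset.coe_Icc, Set.mem_Icc]
        exact ⟨this, hD T hT⟩
      · intro T hT T' hT' heq
        have h1 := Nat.primeFactors_prod (hP T hT)
        have h2 := Nat.primeFactors_prod (hP T' hT')
        simp only at heq
        rw [← h1, ← h2, heq]
    simpa using this
  have hsq : A.card * J ^ 2 ≤ ∑ t ∈ Finset.range N, W t ^ 2 := by
    calc A.card * J ^ 2 = ∑ t ∈ A, W t ^ 2 := by
          rw [Finset.sum_congr rfl fun t ht => by rw [hW t ht]]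
          simp
      _ ≤ _ := Finset.sum_le_sum_of_subset_of_nonneg hA fun _ _ _ => sq_nonneg _
  have hexp : ∑ t ∈ Finset.range N, W t ^ 2 = ∑ T₁ ∈ F, ∑ T₂ ∈ F,
      ((∏ q ∈ T₁, h q) * (∏ q ∈ T₂, h q) *
      ∑ t ∈ Finset.range N, (∏ q ∈ T₁, f q t) * (∏ q ∈ T₂, f q t)) := by
    have e1 : ∀ t, W t ^ 2 = ∑ T₁ ∈ F, ∑ T₂ ∈ F, ((∏ q ∈ T₁, h q) * ∏ q ∈ T₁, f q t) *
        ((∏ q ∈ T₂, h q) * ∏ q ∈ T₂, f q t) := by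
      intro t
      rw [sq, ← Finset.sum_mul_sum]
    simp only [e1]
    rw [Finset.sum_comm]
    refine Finset.sum_congr rfl fun T₁ _ => ?_
    rw [Finset.sum_comm]
    refine Finset.sum_congr rfl fun T₂ _ => ?_
    rw [Finset.mul_sum]
    refine Finset.sum_congr rfl fun t _ => ?_
    ring
  have hU : ∀ (Q : ℕ → Prop), (∀ T ∈ F, ∀ q ∈ T, Q q) → ∀ T₁ ∈ F, ∀ T₂ ∈ F,
      ∀ q ∈ T₁ ∪ T₂, Q q := by
    intro Q hQ T₁ h₁ T₂ h₂ q hq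
    rcases Finset.mem_union.1 hq with hq | hq
    · exact hQ _ h₁ q hq
    · exact hQ _ h₂ q hq
  have hbound : ∑ t ∈ Finset.range N, W t ^ 2 ≤ N * J + (D:ℝ) ^ 4 := by
    rw [hexp]
    calc _ ≤ ∑ T₁ ∈ F, ∑ T₂ ∈ F, ((if T₁ = T₂ then N * ∏ q ∈ T₁, h q else 0) + (D : ℝ) ^ 2) := by
          refine Finset.sum_le_sum fun T₁ h₁ => Finset.sum_le_sum fun T₂ h₂ => ?_
          exact ssp_corr f h T₁ T₂ (hU _ hP _ h₁ _ h₂) (hU _ hper _ h₁ _ h₂)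
            (hU _ hpos _ h₁ _ h₂) (hU _ h0 _ h₁ _ h₂) (hU _ h2 _ h₁ _ h₂) (hU _ hb _ h₁ _ h₂)
            N D (hD _ h₁) (hD _ h₂)
      _ = N * J + (F.card : ℝ) ^ 2 * D ^ 2 := by
          simp only [Finset.sum_add_distrib, Finset.sum_ite_eq, Finset.sum_const, nsmul_eq_mul]
          rw [Finset.sum_congr rfl fun T hT => if_pos hT, ← Finset.mul_sum]
          ring
      _ ≤ N * J + (D : ℝ) ^ 2 * D ^ 2 := by gcongr
      _ = _ := by ring
  have hJ0 : 0 < J := by linarith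
  have := hsq.trans hbound
  have h5 : (A.card : ℝ) ≤ (N * J + (D:ℝ) ^ 4) / J ^ 2 := by
    rw [le_div_iff₀ (by positivity)]; exact this
  refine h5.trans ?_
  rw [add_div]
  refine add_le_add ?_ ?_
  · rw [sq, mul_div_mul_right _ _ hJ0.ne']
  · exact div_le_self (by positivity) (one_le_pow₀ hJ)

/-- positive integers at most `Y` free of primes of `S` -/
def sspA (S : Finset ℕ) (Y : ℕ) : Finset ℕ :=
  (Finset.Icc 1 Y).filter (fun m => ∀ q ∈ S, ¬ q ∣ m)

lemma ssp_A_lower (S : Finset ℕ) (hS : ∀ q ∈ S, q.Prime) (Y : ℕ) :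
    (∏ q ∈ S, (1 - 1 / (q:ℝ))) * Real.log (Y + 1) ≤ ∑ m ∈ sspA S Y, 1 / (m:ℝ) := by
  induction S using Finset.induction_on with
  | empty =>
    have := log_add_one_le_harmonic Y
    simp only [harmonic_eq_sum_Icc] at this
    push_cast at this
    simpa [sspA] using this
  | insert q S hq ih =>
    have ih := ih fun q hq => hS q (Finset.mem_insert_of_mem hq)
    have hqp := hS q (Finset.mem_insert_self _ _)
    have hq0 : (0:ℝ) < q := by exact_mod_cast hqp.pos
    have hq1 : 1 / (q:ℝ) ≤ 1 := by
      rw [div_le_one hq0]; exact_mod_cast hqp.one_lt.le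
    rw [Finset.prod_insert hq, mul_assoc]
    have step : ∑ m ∈ sspA S Y, 1 / (m:ℝ) ≤
        ∑ m ∈ sspA (insert q S) Y, 1 / (m:ℝ) + 1 / q * ∑ m ∈ sspA S Y, 1 / (m:ℝ) := by
      rw [← Finset.sum_filter_add_sum_filter_not (sspA S Y) (fun m => ¬ q ∣ m)]
      refine add_le_add (le_of_eq ?_) ?_
      · refine Finset.sum_congr ?_ fun _ _ => rfl
        ext m
        simp [sspA]; tauto
      · rw [Finset.sum_filter_add_sum_filter_not (sspA S Y) (fun m => ¬ q ∣ m), Finset.mul_sum]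
        have : ∑ m ∈ (sspA S Y).filter (fun m => ¬ ¬ q ∣ m), 1 / (m:ℝ) ≤
            ∑ m ∈ (sspA S Y).image (fun m => q * m), 1 / (m:ℝ) := by
          refine Finset.sum_le_sum_of_subset_of_nonneg ?_ fun _ _ _ => by positivity
          intro m hm
          simp only [sspA, Finset.mem_filter, Finset.mem_Icc, not_not] at hm
          obtain ⟨⟨⟨h1, h2⟩, h3⟩, c, rfl⟩ := hm
          refine Finset.mem_image.2 ⟨c, ?_, rfl⟩
          simp only [sspA, Finset.mem_filter, Finset.mem_Icc]
          refine ⟨⟨Nat.pos_of_mul_pos_left h1, le_trans (Nat.le_mul_of_pos_left _ hqp.pos) h2⟩, ?_⟩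
          intro r hr hrc
          exact h3 r hr (hrc.mul_left q)
        refine this.trans (le_of_eq ?_)
        rw [Finset.sum_image]
        · refine Finset.sum_congr rfl fun m _ => ?_
          push_cast; rw [one_div_mul_one_div]
        · intro a _ b _ hab
          exact Nat.eq_of_mul_eq_mul_left hqp.pos hab
    have := mul_le_mul_of_nonneg_left ih (sub_nonneg.2 hq1)
    linarith

/-- `k^Ω(n)/n` -/
noncomputable def sspg (k n : ℕ) : ℝ := (k:ℝ) ^ n.primeFactorsList.length / n

lemma sspg_nonneg (k n : ℕ) : 0 ≤ sspg k n := by unfold sspg; positivity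

lemma sspg_mul (k q m : ℕ) (hq : q.Prime) (hm : m ≠ 0) :
    sspg k (q * m) = (k / q) * sspg k m := by
  unfold sspg
  rw [(Nat.perm_primeFactorsList_mul hq.ne_zero hm).length_eq]
  simp only [List.length_append, Nat.primeFactorsList_prime hq, List.length_singleton]
  have : (q:ℝ) ≠ 0 := by exact_mod_cast hq.ne_zero
  have : (m:ℝ) ≠ 0 := by exact_mod_cast hm
  push_cast
  field_simp
  ring

lemma ssp_div_sum (k N : ℕ) (hN : N ≠ 0) :
    ∑ d ∈ N.divisors, (k:ℝ) ^ d.primeFactorsList.length ≤ ((k+1:ℕ):ℝ) ^ N.primeFactorsList.length := by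
  induction N using induction_on_primes with
  | zero => exact absurd rfl hN
  | one => simp
  | prime_mul p N hp ih =>
    have hN0 : N ≠ 0 := by rintro rfl; simp at hN
    have ih := ih hN0
    have hsub : (p * N).divisors ⊆ N.divisors ∪ N.divisors.image (fun d => p * d) := by
      intro d hd
      have hd' := Nat.dvd_of_mem_divisors hd
      by_cases hpd : p ∣ d
      · obtain ⟨c, rfl⟩ := hpd
        have := Nat.dvd_of_mul_dvd_mul_left hp.pos hd'
        simp only [Finset.mem_union, Finset.mem_image, Nat.mem_divisors]
        exact Or.inr ⟨c, ⟨this, hN0⟩, rfl⟩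
      · have : d ∣ N := ((Nat.Prime.coprime_iff_not_dvd hp).2 hpd).symm.dvd_of_dvd_mul_left hd'
        simp [this, hN0]
    calc _ ≤ ∑ d ∈ N.divisors ∪ N.divisors.image (fun d => p * d), (k:ℝ) ^ d.primeFactorsList.length :=
          Finset.sum_le_sum_of_subset_of_nonneg hsub fun _ _ _ => by positivity
      _ ≤ ∑ d ∈ N.divisors, (k:ℝ) ^ d.primeFactorsList.length + 
          ∑ d ∈ N.divisors.image (fun d => p * d), (k:ℝ) ^ d.primeFactorsList.length := by
          rw [← Finset.sum_union_inter]
          have : 0 ≤ ∑ d ∈ N.divisors ∩ N.divisors.image (fun d => p * d), (k:ℝ) ^ d.primeFactorsList.length :=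
            Finset.sum_nonneg fun _ _ => by positivity
          linarith
      _ = ∑ d ∈ N.divisors, (k:ℝ) ^ d.primeFactorsList.length + 
          k * ∑ d ∈ N.divisors, (k:ℝ) ^ d.primeFactorsList.length := by
          congr 1
          rw [Finset.sum_image, Finset.mul_sum]
          · refine Finset.sum_congr rfl fun d hd => ?_
            have hd0 : d ≠ 0 := (Nat.pos_of_mem_divisors hd).ne'
            rw [(Nat.perm_primeFactorsList_mul hp.ne_zero hd0).length_eq]
            simp only [List.length_append, Nat.primeFactorsList_prime hp, List.length_singleton]
            ring
          · intro a _ b _ hab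
            exact Nat.eq_of_mul_eq_mul_left hp.pos hab
      _ = ((k+1:ℕ):ℝ) * ∑ d ∈ N.divisors, (k:ℝ) ^ d.primeFactorsList.length := by push_cast; ring
      _ ≤ ((k+1:ℕ):ℝ) * ((k+1:ℕ):ℝ) ^ N.primeFactorsList.length := by gcongr
      _ = _ := by
          rw [(Nat.perm_primeFactorsList_mul hp.ne_zero hN0).length_eq]
          simp only [List.length_append, Nat.primeFactorsList_prime hp, List.length_singleton]
          ring

lemma ssp_G_lower (S : Finset ℕ) (hS : ∀ q ∈ S, q.Prime) (Y : ℕ) (hY : 1 ≤ Y) (k : ℕ) :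
    (∑ m ∈ sspA S Y, 1 / (m:ℝ)) ^ k ≤ ∑ n ∈ sspA S (Y ^ k), sspg k n := by
  induction k with
  | zero =>
    have : 1 ∈ sspA S (Y ^ 0) := by
      simp only [sspA, Finset.mem_filter]
      refine ⟨by simp, fun q hq h => (hS q hq).one_lt.ne' (Nat.dvd_one.1 h)⟩
    refine le_trans ?_ (Finset.single_le_sum (fun n _ => sspg_nonneg 0 n) this)
    simp [sspg]
  | succ k ih =>
    rw [pow_succ]
    have hA0 : 0 ≤ ∑ m ∈ sspA S Y, 1 / (m:ℝ) := Finset.sum_nonneg fun _ _ => by positivity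
    refine (mul_le_mul_of_nonneg_right ih hA0).trans ?_
    rw [Finset.sum_mul_sum, ← Finset.sum_product']
    have hmaps : ∀ x ∈ sspA S (Y ^ k) ×ˢ sspA S Y, x.1 * x.2 ∈ sspA S (Y ^ (k+1)) := by
      rintro ⟨n, m⟩ h
      simp only [sspA, Finset.mem_product, Finset.mem_filter, Finset.mem_Icc] at h ⊢
      obtain ⟨⟨⟨h1, h2⟩, h3⟩, ⟨h4, h5⟩, h6⟩ := h
      refine ⟨⟨Nat.mul_pos h1 h4, ?_⟩, ?_⟩
      · rw [pow_succ]; exact Nat.mul_le_mul h2 h5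
      · intro q hq hd
        rcases (hS q hq).dvd_mul.1 hd with h | h
        · exact h3 q hq h
        · exact h6 q hq h
    rw [← Finset.sum_fiberwise_of_maps_to hmaps]
    refine Finset.sum_le_sum fun N hN => ?_
    have hN0 : N ≠ 0 := by
      simp only [sspA, Finset.mem_filter, Finset.mem_Icc] at hN; omega
    have hNr : (0:ℝ) < N := by exact_mod_cast Nat.pos_of_ne_zero hN0
    calc _ = ∑ x ∈ (sspA S (Y ^ k) ×ˢ sspA S Y).filter (fun x => x.1 * x.2 = N), 
          (k:ℝ) ^ x.1.primeFactorsList.length / N := by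
          refine Finset.sum_congr rfl fun x hx => ?_
          have hx' := (Finset.mem_filter.1 hx).2
          rw [← hx']
          unfold sspg
          push_cast
          rw [div_mul_div_comm, mul_one]
      _ = ∑ d ∈ ((sspA S (Y ^ k) ×ˢ sspA S Y).filter (fun x => x.1 * x.2 = N)).image Prod.fst,
          (k:ℝ) ^ d.primeFactorsList.length / N := by
          rw [Finset.sum_image]
          rintro ⟨a, b⟩ ha ⟨c, d⟩ hc hac
          simp only [Finset.coe_filter, Set.mem_ofPred_eq] at ha hc hac
          subst hac
          have := ha.2.trans hc.2.symm
          have ha0 : 0 < a := by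
            rcases Nat.eq_zero_or_pos a with h | h
            · subst h; simp at ha; omega
            · exact h
          rw [Nat.eq_of_mul_eq_mul_left ha0 this]
      _ ≤ ∑ d ∈ N.divisors, (k:ℝ) ^ d.primeFactorsList.length / N := by
          refine Finset.sum_le_sum_of_subset_of_nonneg ?_ fun _ _ _ => by positivity
          intro d hd
          obtain ⟨x, hx, rfl⟩ := Finset.mem_image.1 hd
          have hx' := (Finset.mem_filter.1 hx).2
          exact Nat.mem_divisors.2 ⟨⟨_, hx'.symm⟩, hN0⟩
      _ ≤ _ := by
          rw [← Finset.sum_div]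
          unfold sspg
          gcongr
          exact ssp_div_sum k N hN0

lemma ssp_fiber (k D : ℕ) (T : Finset ℕ) (hT : ∀ q ∈ T, q.Prime ∧ k < q) :
    ∑ n ∈ (Finset.Icc 1 D).filter (fun n => n.primeFactors = T), sspg k n ≤
      ∏ q ∈ T, ((k:ℝ) / (q - k)) := by
  induction T using Finset.induction_on with
  | empty =>
    have : (Finset.Icc 1 D).filter (fun n => n.primeFactors = ∅) ⊆ {1} := by
      intro n hn
      simp [Nat.primeFactors_eq_empty] at hn
      simp; omega
    refine (Finset.sum_le_sum_of_subset_of_nonneg this fun n _ _ => sspg_nonneg k n).trans ?_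
    simp [sspg]
  | insert q T hq ih =>
    have ih := ih fun q hq => hT q (Finset.mem_insert_of_mem hq)
    obtain ⟨hqp, hkq⟩ := hT q (Finset.mem_insert_self _ _)
    have hq0 : (0:ℝ) < q := by exact_mod_cast hqp.pos
    have hkq' : (k:ℝ) < q := by exact_mod_cast hkq
    set B := ∑ n ∈ (Finset.Icc 1 D).filter (fun n => n.primeFactors = T), sspg k n
    set B' := ∑ n ∈ (Finset.Icc 1 D).filter (fun n => n.primeFactors = insert q T), sspg k n with hB'
    have step : B' ≤ (k / q) * (B' + B) := by
      have hdisj : Disjoint ((Finset.Icc 1 D).filter (fun n => n.primeFactors = insert q T))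
          ((Finset.Icc 1 D).filter (fun n => n.primeFactors = T)) := by
        rw [Finset.disjoint_filter]
        intro n _ h1 h2
        apply hq
        rw [← h2, h1]; exact Finset.mem_insert_self _ _
      rw [← Finset.sum_union hdisj, Finset.mul_sum]
      calc B' ≤ ∑ n ∈ ((Finset.Icc 1 D).filter (fun n => n.primeFactors = insert q T) ∪
              (Finset.Icc 1 D).filter (fun n => n.primeFactors = T)).image (fun m => q * m),
              sspg k n := by
            refine Finset.sum_le_sum_of_subset_of_nonneg ?_ fun _ _ _ => sspg_nonneg _ _
            intro n hn
            simp only [Finset.mem_filter, Finset.mem_Icc] at hn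
            obtain ⟨⟨h1, h2⟩, h3⟩ := hn
            have hqn : q ∣ n := Nat.dvd_of_mem_primeFactors (by rw [h3]; exact Finset.mem_insert_self _ _)
            obtain ⟨m, rfl⟩ := hqn
            have hm0 : 0 < m := Nat.pos_of_mul_pos_left h1
            refine Finset.mem_image.2 ⟨m, ?_, rfl⟩
            have hmD : m ≤ D := le_trans (Nat.le_mul_of_pos_left _ hqp.pos) h2
            rw [Nat.primeFactors_mul hqp.ne_zero hm0.ne', hqp.primeFactors] at h3
            simp only [Finset.mem_union, Finset.mem_filter, Finset.mem_Icc]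
            by_cases hqm : q ∈ m.primeFactors
            · left
              refine ⟨⟨hm0, hmD⟩, ?_⟩
              rw [← h3]; ext r; simp only [Finset.mem_union, Finset.mem_singleton]
              constructor
              · tauto
              · rintro (rfl | h)
                · exact hqm
                · exact h
            · right
              refine ⟨⟨hm0, hmD⟩, ?_⟩
              ext r
              have h4 : r ∈ {q} ∪ m.primeFactors ↔ r ∈ insert q T := by rw [h3]
              simp only [Finset.mem_union, Finset.mem_singleton, Finset.mem_insert] at h4
              by_cases hr : r = q
              · subst hr; tauto
              · tauto
        _ = _ := by
            rw [Finset.sum_image]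
            · refine Finset.sum_congr rfl fun m hm => ?_
              refine sspg_mul k q m hqp ?_
              simp only [Finset.mem_union, Finset.mem_filter, Finset.mem_Icc] at hm
              omega
            · intro a _ b _ hab
              exact Nat.eq_of_mul_eq_mul_left hqp.pos hab
    rw [Finset.prod_insert hq]
    have h5 : B' * (q - k) ≤ k * B := by
      have := mul_le_mul_of_nonneg_left step hq0.le
      have e : (q:ℝ) * (k / q * (B' + B)) = k * (B' + B) := by field_simp
      rw [e] at this
      linarith
    have h6 : B' ≤ k / (q - k) * B := by
      rw [div_mul_eq_mul_div, le_div_iff₀ (by linarith)]; exact h5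
    refine h6.trans (mul_le_mul_of_nonneg_left ih ?_)
    exact div_nonneg (Nat.cast_nonneg _) (by linarith)

lemma ssp_J_lower (S : Finset ℕ) (hS : ∀ q ∈ S, q.Prime) (k Y : ℕ) (hY : 1 ≤ Y)
    (hSk : ∀ q : ℕ, q.Prime → q ≤ k → q ∈ S) :
    ((∏ q ∈ S, (1 - 1 / (q:ℝ))) * Real.log (Y + 1)) ^ k ≤
      ∑ T ∈ (sspA S (Y ^ k)).image Nat.primeFactors, ∏ q ∈ T, ((k:ℝ) / (q - k)) := by
  have h1 := ssp_A_lower S hS Y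
  have h2 : 0 ≤ (∏ q ∈ S, (1 - 1 / (q:ℝ))) * Real.log (Y + 1) := by
    refine mul_nonneg (Finset.prod_nonneg fun q hq => ?_) (Real.log_nonneg (by simp))
    have : (1:ℝ) ≤ q := by exact_mod_cast (hS q hq).one_lt.le
    rw [sub_nonneg]
    exact (div_le_one (by linarith)).2 this
  refine (pow_le_pow_left₀ h2 h1 k).trans ((ssp_G_lower S hS Y hY k).trans ?_)
  rw [← Finset.sum_fiberwise_of_maps_to (g := Nat.primeFactors)
    (t := (sspA S (Y ^ k)).image Nat.primeFactors) (fun x hx => Finset.mem_image_of_mem _ hx)]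
  refine Finset.sum_le_sum fun T hT => ?_
  obtain ⟨n, hn, rfl⟩ := Finset.mem_image.1 hT
  refine le_trans ?_ (ssp_fiber k (Y ^ k) n.primeFactors ?_)
  · refine Finset.sum_le_sum_of_subset_of_nonneg ?_ fun _ _ _ => sspg_nonneg _ _
    refine Finset.filter_subset_filter _ ?_
    exact Finset.filter_subset _ _
  · intro q hq
    have hqp := Nat.prime_of_mem_primeFactors hq
    refine ⟨hqp, ?_⟩
    by_contra! hcon
    exact (Finset.mem_filter.1 hn).2 q (hSk q hqp hcon) (Nat.dvd_of_mem_primeFactors hq)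

lemma ssp_sieve (S : Finset ℕ) (hS : ∀ q ∈ S, q.Prime) (k Y N : ℕ) (hk : 0 < k) (hY : 1 ≤ Y)
    (hSk : ∀ q : ℕ, q.Prime → q ≤ 2 * k → q ∈ S) (bad : ℕ → ℕ → Prop)
    (hper : ∀ q t, bad q (t + q) ↔ bad q t)
    (hcard : ∀ q : ℕ, q.Prime → q ∉ S → q ≤ Y ^ k → 
      ∀ s : Finset ℕ, (∀ t, t ∈ s ↔ t < q ∧ bad q t) → s.card = k)
    (A : Finset ℕ) (hA : A ⊆ Finset.range N)
    (hA1 : ∀ q : ℕ, q.Prime → q ∉ S → q ≤ Y ^ k → ∀ t ∈ A, ¬ bad q t) :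
    (A.card : ℝ) ≤ N / ((∏ q ∈ S, (1 - 1 / (q:ℝ))) * Real.log (Y + 1)) ^ k + ((Y:ℝ) ^ k) ^ 4 := by
  classical
  set F := (sspA S (Y ^ k)).image Nat.primeFactors with hF
  have hmem : ∀ T ∈ F, ∀ q ∈ T, q.Prime ∧ q ∉ S ∧ q ≤ Y ^ k := by
    intro T hT q hq
    obtain ⟨n, hn, rfl⟩ := Finset.mem_image.1 hT
    simp only [sspA, Finset.mem_filter, Finset.mem_Icc] at hn
    have hd := Nat.dvd_of_mem_primeFactors hq
    refine ⟨Nat.prime_of_mem_primeFactors hq, fun h => hn.2 q h hd, 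
      (Nat.le_of_dvd (by omega) hd).trans hn.1.2⟩
  have hJ := ssp_J_lower S hS k Y hY (fun q hq hqk => hSk q hq (by omega))
  have h1F : ∅ ∈ F := by
    refine Finset.mem_image.2 ⟨1, ?_, by simp⟩
    simp only [sspA, Finset.mem_filter, Finset.mem_Icc]
    exact ⟨⟨le_refl _, Nat.one_le_pow _ _ hY⟩, 
      fun q hq h => (hS q hq).one_lt.ne' (Nat.dvd_one.1 h)⟩
  have hkr : (0:ℝ) < k := by exact_mod_cast hk
  have hq2 : ∀ T ∈ F, ∀ q ∈ T, 2 * (k:ℝ) < q := by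
    intro T hT q hq
    obtain ⟨h1, h2, h3⟩ := hmem T hT q hq
    by_contra! hcon
    exact h2 (hSk q h1 (by exact_mod_cast hcon))
  have hpos : ∀ T ∈ F, ∀ q ∈ T, 0 < (k:ℝ) / (q - k) := by
    intro T hT q hq
    have := hq2 T hT q hq
    exact div_pos hkr (by linarith)
  have hJ1 : 1 ≤ ∑ T ∈ F, ∏ q ∈ T, ((k:ℝ) / (q - k)) := by
    have := Finset.single_le_sum (f := fun T : Finset ℕ => ∏ q ∈ T, ((k:ℝ) / ((q:ℝ) - k)))
      (fun T hT => Finset.prod_nonneg fun q hq => (hpos T hT q hq).le) h1F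
    simpa using this
  have hsum : ∀ T ∈ F, ∀ q ∈ T, ∀ u v : ℝ, 
      ∑ t ∈ Finset.range q, (if bad q t then u else v) = k * u + (q - k) * v := by
    intro T hT q hq u v
    obtain ⟨h1, h2, h3⟩ := hmem T hT q hq
    have hc := hcard q h1 h2 h3 ((Finset.range q).filter (bad q)) (by intro t; simp)
    have hc' := Finset.card_filter_add_card_filter_not (s := Finset.range q) (bad q)
    rw [hc, Finset.card_range] at hc'
    rw [Finset.sum_ite, Finset.sum_const, Finset.sum_const, hc]
    have : (k:ℝ) + ((Finset.range q).filter (fun t => ¬ bad q t)).card = q := by exact_mod_cast hc'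
    simp only [nsmul_eq_mul]
    rw [← this]; ring
  have hsel := ssp_selberg (fun q t => if bad q t then 1 - (q:ℝ) / k else 1)
    (fun q => (k:ℝ) / (q - k)) F N (Y ^ k) (fun T hT q hq => (hmem T hT q hq).1)
    (fun T hT q hq t => by simp only [hper q t]) hpos
    (fun T hT q hq => by
      rw [hsum T hT q hq]; field_simp; ring)
    (fun T hT q hq => by
      have := hq2 T hT q hq
      simp only [ite_pow]
      rw [hsum T hT q hq]; field_simp; ring)
    (fun T hT q hq t => by
      have := hq2 T hT q hq
      have e : 1 / ((k:ℝ) / (q - k)) = q / k - 1 := by field_simp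
      have e2 : 2 ≤ (q:ℝ) / k := by rw [le_div_iff₀ hkr]; linarith
      rw [e]
      split_ifs
      · rw [abs_le]; constructor <;> linarith
      · rw [abs_one]; linarith)
    (fun T hT => by
      obtain ⟨n, hn, rfl⟩ := Finset.mem_image.1 hT
      simp only [sspA, Finset.mem_filter, Finset.mem_Icc] at hn
      exact (Nat.le_of_dvd (by omega) (Nat.prod_primeFactors_dvd n)).trans hn.1.2)
    A hA (fun T hT q hq t ht => by
      obtain ⟨h1, h2, h3⟩ := hmem T hT q hq
      simp only [if_neg (hA1 q h1 h2 h3 t ht)]) hJ1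
  push_cast at hsel
  refine hsel.trans ?_
  gcongr
  refine pow_pos (mul_pos (Finset.prod_pos fun q hq => ?_) (Real.log_pos ?_)) k
  · have : (1:ℝ) < q := by exact_mod_cast (hS q hq).one_lt
    rw [sub_pos]
    exact (div_lt_one (by linarith)).2 this
  · have : (1:ℝ) ≤ Y := by exact_mod_cast hY
    linarith

lemma ssp_roots (k p r q : ℕ) (hq : q.Prime) (a b : Fin k → ℤ) (ha : ∀ i, ¬ (q:ℤ) ∣ a i)
    (hp : ¬ q ∣ p) (hab : ∀ i j, i ≠ j → ¬ (q:ℤ) ∣ a i * b j - a j * b i)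
    (s : Finset ℕ) 
    (hs : ∀ t, t ∈ s ↔ t < q ∧ (q:ℤ) ∣ ∏ i, (a i * ((r:ℤ) + p * t) + b i)) : s.card = k := by
  classical
  have : Fact q.Prime := ⟨hq⟩
  have ha' : ∀ i, ((a i : ℤ) : ZMod q) ≠ 0 := fun i h => 
    ha i ((ZMod.intCast_zmod_eq_zero_iff_dvd _ _).1 h)
  have hp' : (p : ZMod q) ≠ 0 := fun h => hp ((ZMod.natCast_eq_zero_iff _ _).1 h)
  let root : Fin k → ZMod q := fun i => -((a i : ZMod q) * r + b i) / (a i * p)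
  have hinj : Function.Injective fun i => (root i).val := by
    intro i j hij
    have h1 : root i = root j := ZMod.val_injective q hij
    by_contra hne
    apply hab i j hne
    rw [← ZMod.intCast_zmod_eq_zero_iff_dvd]
    simp only [root] at h1
    have hi := ha' i
    have hj := ha' j
    field_simp at h1
    push_cast
    linear_combination h1
  have : s = Finset.univ.image fun i => (root i).val := by
    ext t
    rw [hs]
    simp only [Finset.mem_image, Finset.mem_univ, true_and]
    have hroot : ∀ i, (t : ZMod q) = root i ↔ (q:ℤ) ∣ a i * ((r:ℤ) + p * t) + b i := by
      intro i
      rw [← ZMod.intCast_zmod_eq_zero_iff_dvd]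
      have hi := ha' i
      simp only [root]
      rw [eq_div_iff (mul_ne_zero hi hp')]
      push_cast
      constructor
      · intro h; linear_combination h
      · intro h; linear_combination h
    constructor
    · rintro ⟨htq, hd⟩
      obtain ⟨i, _, hi⟩ := (Prime.dvd_finsetProd_iff (Nat.prime_iff_prime_int.1 hq) _).1 hd
      refine ⟨i, ?_⟩
      rw [← (hroot i).2 hi]
      exact ZMod.val_cast_of_lt htq
    · rintro ⟨i, rfl⟩
      refine ⟨ZMod.val_lt _, ?_⟩
      refine dvd_trans ((hroot i).1 ?_) (Finset.dvd_prod_of_mem _ (Finset.mem_univ i))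
      simp
  rw [this, Finset.card_image_of_injective _ hinj]
  simp

lemma ssp_prod_bound (S : Finset ℕ) (hS : ∀ q ∈ S, q.Prime) (k : ℕ) :
    (1 / 2 : ℝ) ^ S.card * ((1 / 2) ^ k) ^ (2 * k) ≤ (∏ q ∈ S, (1 - 1 / (q:ℝ))) ^ k := by
  classical
  rw [← Finset.prod_pow]
  have h1 : ∀ q ∈ S, (1 / 2 : ℝ) * (if q < 2 * k then (1 / 2) ^ k else 1) ≤ (1 - 1 / (q:ℝ)) ^ k := by
    intro q hq
    have hq2 : (2:ℝ) ≤ q := by exact_mod_cast (hS q hq).two_le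
    have hq3 : 1 / (q:ℝ) ≤ 1 / 2 := one_div_le_one_div_of_le (by norm_num) hq2
    split_ifs with h
    · calc (1 / 2 : ℝ) * (1 / 2) ^ k ≤ 1 * (1 / 2) ^ k := by gcongr; norm_num
        _ = (1 / 2) ^ k := by ring
        _ ≤ _ := by gcongr; linarith
    · have hb := one_add_mul_le_pow (a := - (1 / (q:ℝ))) (by linarith) k
      have : (k:ℝ) * (1 / q) ≤ 1 / 2 := by
        rw [mul_one_div, div_le_iff₀ (by linarith)]
        have : (2 * k : ℝ) ≤ q := by exact_mod_cast not_lt.1 h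
        linarith
      rw [← sub_eq_add_neg] at hb
      linarith
  refine le_trans ?_ (Finset.prod_le_prod (fun q _ => by positivity) h1)
  rw [Finset.prod_mul_distrib, Finset.prod_const]
  refine mul_le_mul_of_nonneg_left ?_ (by positivity)
  rw [Finset.prod_ite, Finset.prod_const, Finset.prod_const_one, mul_one]
  refine pow_le_pow_of_le_one (by positivity) (pow_le_one₀ (by norm_num) (by norm_num)) ?_
  calc _ ≤ (Finset.range (2 * k)).card := Finset.card_le_card (by intro q hq; simp at hq ⊢; omega)
    _ = 2 * k := by simp

lemma ssp_dvd_P (S : Finset ℕ) (z : ℝ) (q : ℕ) (hq : q.Prime) (hqz : (q:ℝ) < z) (hqS : q ∉ S) :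
    q ∣ sievePSigma S z := by
  classical
  unfold sievePSigma
  refine Finset.dvd_prod_of_mem (fun p : ℕ => p) ?_
  simp only [Finset.mem_filter, Finset.mem_range]
  refine ⟨?_, hq, hqz, hqS⟩
  have : (q:ℝ) < ⌈z⌉₊ := hqz.trans_le (Nat.le_ceil z)
  have : q < ⌈z⌉₊ := by exact_mod_cast this
  omega

lemma ssp_omega (k : ℕ) (S : Finset ℕ) (a b : Fin k → ℤ) (x z : ℝ) (n : ℕ)
    (hn : n ∈ sieveOmega S a b x z) (q : ℕ) (hq : q.Prime) (hqz : (q:ℝ) < z) (hqS : q ∉ S) :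
    ¬ (q:ℤ) ∣ ∏ i, (a i * n + b i) := by
  intro hd
  have h1 := hn.2.2
  have h2 : (q:ℤ) ∣ (sievePSigma S z : ℤ) := by exact_mod_cast ssp_dvd_P S z q hq hqz hqS
  have h3 := Int.dvd_coe_gcd hd h2
  rw [h1] at h3
  have : q ∣ 1 := by exact_mod_cast h3
  exact hq.one_lt.ne' (Nat.dvd_one.1 this)

lemma ssp_z (k M : ℕ) (hk : 0 < k) : ∃ z₃ : ℝ, 2 ≤ z₃ ∧ ∀ z : ℝ, z₃ ≤ z →
    2 * (M:ℝ) * z ^ (1/2:ℝ) ≤ z ∧ (Real.log z) ^ k * z ^ (1/4:ℝ) ≤ z ^ (1/2:ℝ) := by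
  have h1 := (isLittleO_log_rpow_rpow_atTop (k:ℝ) (show (0:ℝ) < 1/4 by norm_num)).bound
    (show (0:ℝ) < 1 by norm_num)
  have h2 := (tendsto_rpow_atTop (show (0:ℝ) < 1/2 by norm_num)).eventually_ge_atTop (2 * (M:ℝ))
  obtain ⟨w, hw⟩ := Filter.eventually_atTop.1 (h1.and h2)
  refine ⟨max w 2, le_max_right _ _, fun z hz => ?_⟩
  have hz2 : 2 ≤ z := (le_max_right _ _).trans hz
  obtain ⟨h3, h4⟩ := hw z ((le_max_left _ _).trans hz)
  have hz0 : 0 < z := by linarith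
  constructor
  · calc _ ≤ z ^ (1/2:ℝ) * z ^ (1/2:ℝ) := by gcongr
      _ = z := by rw [← Real.rpow_add hz0]; norm_num
  · rw [Real.rpow_natCast, one_mul] at h3
    have h5 : (Real.log z) ^ k ≤ z ^ (1/4:ℝ) := by
      refine (le_abs_self _).trans (h3.trans (le_of_eq ?_))
      exact abs_of_nonneg (by positivity)
    calc _ ≤ z ^ (1/4:ℝ) * z ^ (1/4:ℝ) := by gcongr
      _ = _ := by rw [← Real.rpow_add hz0]; norm_num

/-- final numerical estimate -/
lemma ssp_final (k : ℕ) (hk : 0 < k) (S : Finset ℕ) (hS : ∀ q ∈ S, q.Prime) (z X : ℝ) (hz : 2 ≤ z)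
    (hX : z ^ (1/2:ℝ) ≤ X) (hlog : (Real.log z) ^ k * z ^ (1/4:ℝ) ≤ z ^ (1/2:ℝ)) :
    ((⌊X⌋₊ + 1 : ℕ):ℝ) / ((∏ q ∈ S, (1 - 1 / (q:ℝ))) * 
      Real.log ((⌊z ^ (1 / (16 * k) : ℝ)⌋₊ : ℕ) + 1)) ^ k +
      (((⌊z ^ (1 / (16 * k) : ℝ)⌋₊ : ℕ) : ℝ) ^ k) ^ 4 ≤
    (2 * (16 * k) ^ k * (2 ^ k) ^ (2 * k) + 2) * 2 ^ S.card * X / (Real.log z) ^ k := by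
  have hz0 : 0 < z := by linarith
  have hkr : (0:ℝ) < k := by exact_mod_cast hk
  have hl : 0 < Real.log z := Real.log_pos (by linarith)
  have hX1 : 1 ≤ X := (Real.one_le_rpow (by linarith) (by norm_num)).trans hX
  set Y := ⌊z ^ (1 / (16 * k) : ℝ)⌋₊
  have e1 : Real.log z / (16 * k) ≤ Real.log ((Y:ℝ) + 1) := by
    have : Real.log (z ^ (1 / (16 * k) : ℝ)) = Real.log z / (16 * k) := by
      rw [Real.log_rpow hz0]; ring
    rw [← this]
    exact Real.log_le_log (by positivity) (Nat.lt_floor_add_one _).le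
  have e2 : ((Y:ℝ) ^ k) ^ 4 ≤ z ^ (1/4:ℝ) := by
    have : (Y:ℝ) ≤ z ^ (1 / (16 * k) : ℝ) := Nat.floor_le (by positivity)
    calc ((Y:ℝ) ^ k) ^ 4 ≤ ((z ^ (1 / (16 * k) : ℝ)) ^ k) ^ 4 := by gcongr
      _ = z ^ (1/4:ℝ) := by
        rw [← pow_mul, ← Real.rpow_natCast, ← Real.rpow_mul hz0.le]
        congr 1
        push_cast
        field_simp
        norm_num
  have e3 : z ^ (1/4:ℝ) ≤ X / (Real.log z) ^ k := by
    rw [le_div_iff₀ (by positivity)]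
    linarith
  have e4 : ((⌊X⌋₊ + 1 : ℕ):ℝ) ≤ 2 * X := by
    have := Nat.floor_le (show 0 ≤ X by linarith)
    push_cast; linarith
  have e5 := ssp_prod_bound S hS k
  have e6 : (1 / 2 : ℝ) ^ S.card * ((1 / 2) ^ k) ^ (2 * k) * (Real.log z / (16 * k)) ^ k ≤
      ((∏ q ∈ S, (1 - 1 / (q:ℝ))) * Real.log ((Y:ℝ) + 1)) ^ k := by
    rw [mul_pow]
    gcongr
    exact le_trans (by positivity) e5
  have e7 : ((⌊X⌋₊ + 1 : ℕ):ℝ) / ((∏ q ∈ S, (1 - 1 / (q:ℝ))) * Real.log ((Y:ℝ) + 1)) ^ k ≤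
      2 * X / ((1 / 2 : ℝ) ^ S.card * ((1 / 2) ^ k) ^ (2 * k) * (Real.log z / (16 * k)) ^ k) := by
    gcongr
  have e8 : 2 * X / ((1 / 2 : ℝ) ^ S.card * ((1 / 2) ^ k) ^ (2 * k) * (Real.log z / (16 * k)) ^ k)
      = 2 * (16 * k) ^ k * (2 ^ k) ^ (2 * k) * 2 ^ S.card * (X / (Real.log z) ^ k) := by
    simp only [one_div, inv_pow, div_pow]
    field_simp
  have e9 : (1:ℝ) ≤ 2 ^ S.card := one_le_pow₀ (by norm_num)
  have e10 : 0 ≤ X / (Real.log z) ^ k := by positivity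
  calc _ ≤ 2 * (16 * k) ^ k * (2 ^ k) ^ (2 * k) * 2 ^ S.card * (X / (Real.log z) ^ k) + 
        X / (Real.log z) ^ k := by linarith
    _ ≤ 2 * (16 * k) ^ k * (2 ^ k) ^ (2 * k) * 2 ^ S.card * (X / (Real.log z) ^ k) + 
        2 * 2 ^ S.card * (X / (Real.log z) ^ k) := by
        gcongr
        nlinarith
    _ = _ := by ring

/-- For an individual prime `p ∉ Σ`: writing `L(n) = L_k(n) = a_k n + b_k` and
`M = max{|a_k|, |b_k|}`, and assuming every prime of `Σ` divides `a_k`, there exist `C₃ ≥ 2`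
depending only on `k` and `z₃ ≥ 2` depending on `k` and `M`, such that for `x ≥ z ≥ z₃` the
set `Ω₁(x,z)` has at most `C₃·2^{#Σ}·(x/p)·(log z)^{−k}` elements `n` with `p ∣ L(n)`. -/
theorem sieve_single_prime_divisor (k : ℕ) (hk : 0 < k) :
    ∃ C₃ : ℝ, 2 ≤ C₃ ∧
      ∀ M : ℕ, ∃ z₃ : ℝ, 2 ≤ z₃ ∧
        ∀ S : Finset ℕ, (∀ p ∈ S, p.Prime) →
          ∀ a b : Fin k → ℤ, SieveHypotheses S a b →
            (∀ p ∈ S, (p : ℤ) ∣ a ⟨k - 1, by omega⟩) →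
            M = max (a ⟨k - 1, by omega⟩).natAbs (b ⟨k - 1, by omega⟩).natAbs →
            ∀ p : ℕ, p.Prime → p ∉ S →
              ∀ x z : ℝ, z₃ ≤ z → z ≤ x →
                (Nat.card {n ∈ sieveOmega1 S a b x z |
                    (p : ℤ) ∣ (a ⟨k - 1, by omega⟩ * n + b ⟨k - 1, by omega⟩)} : ℝ) ≤
                  C₃ * 2 ^ S.card * (x / p) / (Real.log z) ^ k := by
  refine ⟨2 * (16 * k) ^ k * (2 ^ k) ^ (2 * k) + 2, by
    have : (0:ℝ) ≤ 2 * (16 * k) ^ k * (2 ^ k) ^ (2 * k) := by positivity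
    linarith, fun M => ?_⟩
  obtain ⟨z₃, hz₃, hz₃'⟩ := ssp_z k M hk
  refine ⟨z₃, hz₃, ?_⟩
  intro S hS a b hyp hSa hM p hp hpS x z hz hzx
  obtain ⟨hyp1, hyp2, hyp3, hyp4⟩ := hyp
  obtain ⟨hzA, hzB⟩ := hz₃' z hz
  have hz2 : 2 ≤ z := hz₃.trans hz
  have hz0 : 0 < z := by linarith
  have hp0 : (0:ℝ) < p := by exact_mod_cast hp.pos
  have hl : 0 < Real.log z := Real.log_pos (by linarith)
  have hx0 : 0 < x := by linarith
  set l : Fin k := ⟨k - 1, by omega⟩ with hldef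
  -- consequences of the unit hypothesis
  have hqa : ∀ q : ℕ, q.Prime → q ∉ S → ∀ i, ¬ (q:ℤ) ∣ a i := by
    intro q hq hqS i hd
    refine hqS (hyp4 q hq ?_)
    exact ((hd.trans (Finset.dvd_prod_of_mem a (Finset.mem_univ i))).mul_left _).mul_right _
  have hqab' : ∀ q : ℕ, q.Prime → q ∉ S → ∀ i j, i < j → ¬ (q:ℤ) ∣ a i * b j - a j * b i := by
    intro q hq hqS i j hij hd
    refine hqS (hyp4 q hq ?_)
    refine Dvd.dvd.mul_left (hd.trans ?_) _
    exact Finset.dvd_prod_of_mem (fun q : Fin k × Fin k => a q.1 * b q.2 - a q.2 * b q.1)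
      (a := (i, j)) (by simp [hij])
  have hqab : ∀ q : ℕ, q.Prime → q ∉ S → ∀ i j, i ≠ j → ¬ (q:ℤ) ∣ a i * b j - a j * b i := by
    intro q hq hqS i j hij
    rcases lt_or_gt_of_ne hij with h | h
    · exact hqab' q hq hqS i j h
    · intro hd
      refine hqab' q hq hqS j i h ?_
      have e : a j * b i - a i * b j = -(a i * b j - a j * b i) := by ring
      rw [e, dvd_neg]
      exact hd
  have hSk : ∀ q : ℕ, q.Prime → q ≤ 2 * k → q ∈ S := by
    intro q hq hqk
    refine hyp4 q hq ?_
    refine Dvd.dvd.mul_right (Dvd.dvd.mul_right ?_ _) _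
    exact_mod_cast (hq.dvd_factorial).2 hqk
  set E : Set ℕ := {n ∈ sieveOmega1 S a b x z | (p : ℤ) ∣ (a l * n + b l)} with hE
  have hfin : E.Finite := by
    refine (Set.finite_Icc 1 ⌊x⌋₊).subset fun n hn => ?_
    exact ⟨hn.1.1.1, Nat.le_floor hn.1.1.2.1⟩
  rcases E.eq_empty_or_nonempty with hemp | ⟨n₀, hn₀⟩
  · rw [hemp]
    simp only [Nat.card_coe_set_eq, Set.ncard_empty, Nat.cast_zero]
    positivity
  have hdvdprod : ∀ (n : ℕ) (q : ℕ), (q:ℤ) ∣ a l * n + b l → (q:ℤ) ∣ ∏ i, (a i * n + b i) :=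
    fun n q h => h.trans (Finset.dvd_prod_of_mem (fun i => a i * (n:ℤ) + b i) (Finset.mem_univ l))
  have hzp : z ≤ p := by
    by_contra! hcon
    exact ssp_omega k S a b x z n₀ hn₀.1.1 p hp hcon hpS (hdvdprod n₀ p hn₀.2)
  -- the size of x / p
  have hX : z ^ (1/2:ℝ) ≤ x / p := by
    obtain ⟨c, d, hc, hd, hcd⟩ := (hn₀.1.2 l).2
    have hm : ∃ m : ℤ, 1 < m ∧ a l * n₀ + b l = p * m := by
      have hpd := hn₀.2
      rw [hcd] at hpd
      have hp0' : (0:ℤ) < p := by exact_mod_cast hp.pos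
      rcases (Nat.prime_iff_prime_int.1 hp).dvd_mul.1 hpd with ⟨c', rfl⟩ | ⟨c', rfl⟩
      · have hc' : 0 < c' := by
          by_contra! hcon
          nlinarith
        exact ⟨c' * d, by nlinarith, by rw [hcd]; ring⟩
      · have hc' : 0 < c' := by
          by_contra! hcon
          nlinarith
        exact ⟨c' * c, by nlinarith, by rw [hcd]; ring⟩
    obtain ⟨m, hm1, hm⟩ := hm
    have hq := Int.exists_prime_and_dvd (n := m) (by omega)
    obtain ⟨q', hq'p, hq'd⟩ := hq
    have hqp : q'.natAbs.Prime := Int.prime_iff_natAbs_prime.1 hq'p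
    set q := q'.natAbs
    have hqd : (q:ℤ) ∣ m := Int.natAbs_dvd.2 hq'd
    have hqL : (q:ℤ) ∣ a l * n₀ + b l := by rw [hm]; exact hqd.mul_left _
    have hqS : q ∉ S := by
      intro hqS
      have h1 := hSa q hqS
      have h2 : (q:ℤ) ∣ b l := (dvd_add_right (h1.mul_right _)).1 hqL
      have h3 := Int.dvd_coe_gcd h1 h2
      rw [hyp2 l] at h3
      have : q ∣ 1 := by exact_mod_cast h3
      exact hqp.one_lt.ne' (Nat.dvd_one.1 this)
    have hzq : z ≤ q := by
      by_contra! hcon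
      exact ssp_omega k S a b x z n₀ hn₀.1.1 q hqp hcon hqS (hdvdprod n₀ q hqL)
    have hzm : z ≤ (m:ℝ) := hzq.trans (by exact_mod_cast Int.le_of_dvd (by omega) hqd)
    have haM : ((a l : ℤ):ℝ) ≤ M := by
      have h1 : a l ≤ (a l).natAbs := Int.le_natAbs
      have h2 : (a l).natAbs ≤ M := by rw [hM]; exact le_max_left _ _
      have : a l ≤ (M:ℤ) := by omega
      exact_mod_cast this
    have hbM : ((b l : ℤ):ℝ) ≤ M := by
      have h1 : b l ≤ (b l).natAbs := Int.le_natAbs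
      have h2 : (b l).natAbs ≤ M := by rw [hM]; exact le_max_right _ _
      have : b l ≤ (M:ℤ) := by omega
      exact_mod_cast this
    have hM0 : (0:ℝ) < M := by
      have h1 : 0 < (a l).natAbs := Int.natAbs_pos.2 (hyp1 l)
      have h2 : (a l).natAbs ≤ M := by rw [hM]; exact le_max_left _ _
      exact_mod_cast lt_of_lt_of_le h1 h2
    have hn₀x : (n₀:ℝ) ≤ x := hn₀.1.1.2.1
    have hmr : ((a l : ℤ):ℝ) * n₀ + b l = p * m := by exact_mod_cast hm
    have h1 : (p:ℝ) * z ≤ 2 * M * x := by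
      have h2 : ((a l : ℤ):ℝ) * n₀ ≤ M * x := by
        calc _ ≤ (M:ℝ) * n₀ := by gcongr
          _ ≤ _ := by gcongr
      have h3 : (p:ℝ) * z ≤ p * m := by gcongr
      have h4 : (M:ℝ) ≤ M * x := le_mul_of_one_le_right hM0.le (by linarith)
      linarith
    rw [le_div_iff₀ hp0]
    have h5 : 2 * (M:ℝ) * (z ^ (1/2:ℝ) * p) ≤ 2 * M * x := by
      calc _ = (2 * (M:ℝ) * z ^ (1/2:ℝ)) * p := by ring
        _ ≤ z * p := by gcongr
        _ ≤ _ := by linarith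
    exact le_of_mul_le_mul_left h5 (by positivity)
  -- reduce to t = n / p
  have hmod : ∀ n ∈ E, n % p = n₀ % p := by
    intro n hn
    have h1 : (p:ℤ) ∣ a l * ((n:ℤ) - n₀) := by
      have e : a l * ((n:ℤ) - n₀) = (a l * n + b l) - (a l * n₀ + b l) := by ring
      rw [e]
      exact dvd_sub hn.2 hn₀.2
    have h2 : (p:ℤ) ∣ (n:ℤ) - n₀ :=
      ((Nat.prime_iff_prime_int.1 hp).dvd_mul.1 h1).resolve_left (hqa p hp hpS l)
    have h3 : n₀ ≡ n [MOD p] := (Nat.modEq_iff_dvd).2 h2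
    exact h3.symm
  have hdecomp : ∀ n ∈ E, n = n₀ % p + p * (n / p) := by
    intro n hn
    rw [← hmod n hn]; exact (Nat.mod_add_div n p).symm
  set A : Finset ℕ := hfin.toFinset.image (fun n => n / p) with hA
  have hAcard : Nat.card E = A.card := by
    rw [Nat.card_coe_set_eq, Set.ncard_eq_toFinset_card E hfin, hA, Finset.card_image_of_injOn]
    intro n hn m hm hnm
    have hn' : n ∈ E := by simpa using hn
    have hm' : m ∈ E := by simpa using hm
    simp only at hnm
    rw [hdecomp n hn', hdecomp m hm', hnm]
  rw [hAcard]
  have hY1 : 1 ≤ ⌊z ^ (1 / (16 * k) : ℝ)⌋₊ := by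
    rw [Nat.one_le_floor_iff]
    exact Real.one_le_rpow (by linarith) (by positivity)
  have hYz : (((⌊z ^ (1 / (16 * k) : ℝ)⌋₊) ^ k : ℕ) : ℝ) < z := by
    have hkr : (0:ℝ) < k := by exact_mod_cast hk
    have : ((⌊z ^ (1 / (16 * k) : ℝ)⌋₊ : ℕ):ℝ) ≤ z ^ (1 / (16 * k) : ℝ) :=
      Nat.floor_le (by positivity)
    push_cast
    calc _ ≤ (z ^ (1 / (16 * k) : ℝ)) ^ k := by gcongr
      _ = z ^ (1/16:ℝ) := by
        rw [← Real.rpow_natCast, ← Real.rpow_mul hz0.le]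
        congr 1
        field_simp
      _ < z ^ (1:ℝ) := Real.rpow_lt_rpow_of_exponent_lt (by linarith) (by norm_num)
      _ = z := Real.rpow_one z
  have hsv := ssp_sieve S hS k ⌊z ^ (1 / (16 * k) : ℝ)⌋₊ (⌊x / p⌋₊ + 1) hk hY1 hSk
    (fun q t => (q:ℤ) ∣ ∏ i, (a i * (((n₀ % p : ℕ):ℤ) + p * (t:ℤ)) + b i))
    (by
      intro q t
      generalize n₀ % p = r
      have e : ∀ u : ℤ, ((∏ i, (a i * ((r:ℤ) + p * u) + b i) : ℤ) : ZMod q) =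
          ∏ i, ((a i : ZMod q) * ((r : ZMod q) + p * (u : ZMod q)) + b i) := by
        intro u; push_cast; rfl
      simp only [← ZMod.intCast_zmod_eq_zero_iff_dvd]
      rw [e, e]
      simp)
    (by
      intro q hq hqS hqY s hs
      refine ssp_roots k p (n₀ % p) q hq a b (hqa q hq hqS) ?_ (hqab q hq hqS) s hs
      intro hd
      have h1 : q = p := (Nat.prime_dvd_prime_iff_eq hq hp).1 hd
      have h2 : (q:ℝ) < z := lt_of_le_of_lt (by exact_mod_cast hqY) hYz
      rw [h1] at h2
      linarith)
    A
    (by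
      intro t ht
      obtain ⟨n, hn, rfl⟩ := Finset.mem_image.1 ht
      have hn' : n ∈ E := by simpa using hn
      rw [Finset.mem_range, Nat.lt_succ_iff]
      refine Nat.le_floor ?_
      have h1 : ((n / p : ℕ):ℝ) ≤ (n:ℝ) / p := Nat.cast_div_le
      have h2 : (n:ℝ) ≤ x := hn'.1.1.2.1
      exact h1.trans (by gcongr))
    (by
      intro q hq hqS hqY t ht
      obtain ⟨n, hn, rfl⟩ := Finset.mem_image.1 ht
      have hn' : n ∈ E := by simpa using hn
      have h2 : (q:ℝ) < z := lt_of_le_of_lt (by exact_mod_cast hqY) hYz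
      have h3 := ssp_omega k S a b x z n hn'.1.1 q hq h2 hqS
      have h4 : ((n₀ % p : ℕ):ℤ) + p * ((n / p : ℕ):ℤ) = n := by exact_mod_cast (hdecomp n hn').symm
      simp only [h4]
      exact h3)
  exact hsv.trans (ssp_final k hk S hS z (x / p) hz2 hX hzB)
end

section
/- Let 𝒫 be a set of prime numbers, ε ∈ (0, 1/2] and z₀ ≥ 2. Assume that π_𝒫(t) ≤ ε·π(t) for all t ≥ z₀. Then for all x ≥ z ≥ z₀ one has Σ_{p ∈ 𝒫, z ≤ p < x} 1/p ≪ ε·log(log x / log z) + ε, the implied constant being absolute. -/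
theorem aux_pi (x : ℝ) (hx : 1 < x) :
    (Nat.card {p : ℕ | p.Prime ∧ (p : ℝ) ≤ x} : ℝ) ≤ 6 * x / Real.log x := by
  have h1 : Nat.card {p : ℕ | p.Prime ∧ (p : ℝ) ≤ x} = Nat.primeCounting ⌊x⌋₊ := by
    rw [← Nat.primesLE_card_eq_primeCounting, ← Set.ncard_coe_finset, Nat.card_coe_set_eq]
    congr 1
    ext p
    simp [Nat.mem_primesLE, Nat.le_floor_iff (by linarith : (0:ℝ) ≤ x), and_comm]
  rw [h1]
  refine (Chebyshev.pi_le_log4_mul_div hx).trans ?_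
  have hs : Real.log √x = Real.log x / 2 := Real.log_sqrt (by linarith)
  have hl : 0 < Real.log x := Real.log_pos hx
  have hq : √x * √x = x := Real.mul_self_sqrt (by linarith)
  have hq0 : 0 < √x := Real.sqrt_pos.2 (by linarith)
  have h2 : Real.log √x ≤ √x - 1 := Real.log_le_sub_one_of_pos hq0
  have h4 : Real.log 4 = 2 * Real.log 2 := by
    rw [show (4:ℝ) = 2 ^ 2 by norm_num, Real.log_pow]; norm_num
  have := Real.log_two_lt_d9
  rw [hs] at h2 ⊢
  rw [le_div_iff₀ hl, add_mul]
  have e : Real.log 4 * x / (Real.log x / 2) * Real.log x = 2 * Real.log 4 * x := by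
    field_simp
  rw [e]
  nlinarith

theorem aux_log (y : ℝ) (hy : 2 ≤ y) :
    12 / Real.log (2 * y) ≤ 18 * (Real.log (Real.log (2 * y)) - Real.log (Real.log y)) := by
  have hl : 0 < Real.log y := Real.log_pos (by linarith)
  have h2 := Real.log_two_gt_d9
  have e : Real.log (2 * y) = Real.log 2 + Real.log y := Real.log_mul (by norm_num) (by linarith)
  have hL : 0 < Real.log (2 * y) := by rw [e]; linarith
  have h := Real.log_le_sub_one_of_pos (div_pos hl hL)
  rw [Real.log_div hl.ne' hL.ne'] at h
  have h3 : 12 / Real.log (2 * y) ≤ 18 * (1 - Real.log y / Real.log (2 * y)) := by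
    rw [div_le_iff₀ hL]
    have : 18 * (1 - Real.log y / Real.log (2 * y)) * Real.log (2 * y)
      = 18 * (Real.log (2 * y) - Real.log y) := by field_simp
    rw [this, e]; linarith
  linarith

open Classical in
theorem aux_block (P : Set ℕ) (ε y : ℝ) (hε : 0 < ε) (hy : 2 ≤ y)
    (h : (Nat.card {p : ℕ | p ∈ P ∧ (p : ℝ) ≤ 2 * y} : ℝ) ≤
              ε * (Nat.card {p : ℕ | p.Prime ∧ (p : ℝ) ≤ 2 * y} : ℝ)) (N : ℕ) :
    ∑ p ∈ Finset.filter (fun p : ℕ => p ∈ P ∧ y ≤ (p : ℝ) ∧ (p : ℝ) < 2 * y)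
                (Finset.range N), (1 : ℝ) / p ≤
      18 * ε * (Real.log (Real.log (2 * y)) - Real.log (Real.log y)) := by
  have h1 : ∑ p ∈ Finset.filter (fun p : ℕ => p ∈ P ∧ y ≤ (p : ℝ) ∧ (p : ℝ) < 2 * y)
                (Finset.range N), (1 : ℝ) / p ≤
      (Finset.filter (fun p : ℕ => p ∈ P ∧ y ≤ (p : ℝ) ∧ (p : ℝ) < 2 * y)
                (Finset.range N)).card • (1 / y) := by
    refine Finset.sum_le_card_nsmul _ _ _ fun p hp => ?_
    simp only [Finset.mem_filter] at hp
    exact one_div_le_one_div_of_le (by linarith) hp.2.2.1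
  have hfin : {p : ℕ | p ∈ P ∧ (p : ℝ) ≤ 2 * y}.Finite := by
    refine (Set.finite_Iic ⌊2 * y⌋₊).subset fun p hp => ?_
    exact Nat.le_floor hp.2
  have h2 : (Finset.filter (fun p : ℕ => p ∈ P ∧ y ≤ (p : ℝ) ∧ (p : ℝ) < 2 * y)
                (Finset.range N)).card ≤ Nat.card {p : ℕ | p ∈ P ∧ (p : ℝ) ≤ 2 * y} := by
    rw [← Set.ncard_coe_finset, Nat.card_coe_set_eq]
    refine Set.ncard_le_ncard (fun p hp => ?_) hfin
    simp only [Finset.coe_filter, Set.mem_setOf_eq] at hp ⊢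
    exact ⟨hp.2.1, hp.2.2.2.le⟩
  have h2' : ((Finset.filter (fun p : ℕ => p ∈ P ∧ y ≤ (p : ℝ) ∧ (p : ℝ) < 2 * y)
                (Finset.range N)).card : ℝ) ≤ Nat.card {p : ℕ | p ∈ P ∧ (p : ℝ) ≤ 2 * y} := by
    exact_mod_cast h2
  have h3 := aux_pi (2 * y) (by linarith)
  have h4 := aux_log y hy
  rw [nsmul_eq_mul] at h1
  have hy0 : 0 < 1 / y := by positivity
  calc _ ≤ _ := h1
    _ ≤ (ε * (6 * (2 * y) / Real.log (2 * y))) * (1 / y) := by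
      refine mul_le_mul_of_nonneg_right ?_ hy0.le
      exact (h2'.trans h).trans (mul_le_mul_of_nonneg_left h3 hε.le)
    _ = ε * (12 / Real.log (2 * y)) := by field_simp; ring
    _ ≤ ε * (18 * (Real.log (Real.log (2 * y)) - Real.log (Real.log y))) :=
      mul_le_mul_of_nonneg_left h4 hε.le
    _ = _ := by ring

open Classical in
theorem aux_induct (P : Set ℕ) (ε z : ℝ) (hε : 0 < ε) (hz : 2 ≤ z)
    (h : ∀ t : ℝ, z ≤ t → (Nat.card {p : ℕ | p ∈ P ∧ (p : ℝ) ≤ t} : ℝ) ≤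
              ε * (Nat.card {p : ℕ | p.Prime ∧ (p : ℝ) ≤ t} : ℝ)) (N K : ℕ) :
    ∑ p ∈ Finset.filter (fun p : ℕ => p ∈ P ∧ z ≤ (p : ℝ) ∧ (p : ℝ) < 2 ^ K * z)
                (Finset.range N), (1 : ℝ) / p ≤
      18 * ε * (Real.log (Real.log (2 ^ K * z)) - Real.log (Real.log z)) := by
  induction K with
  | zero =>
    rw [Finset.filter_false_of_mem]
    · simp
    · rintro p - ⟨-, h1, h2⟩
      simp at h2
      linarith
  | succ K ih =>
    have hK : (1:ℝ) ≤ 2 ^ K := one_le_pow₀ (by norm_num)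
    have hy : z ≤ 2 ^ K * z := by nlinarith
    have hb := aux_block P ε (2 ^ K * z) hε (by linarith) (h _ (by linarith)) N
    have e : (2:ℝ) ^ (K + 1) * z = 2 * (2 ^ K * z) := by ring
    rw [e]
    have hs : Finset.filter (fun p : ℕ => p ∈ P ∧ z ≤ (p : ℝ) ∧ (p : ℝ) < 2 * (2 ^ K * z))
          (Finset.range N) ⊆
        Finset.filter (fun p : ℕ => p ∈ P ∧ z ≤ (p : ℝ) ∧ (p : ℝ) < 2 ^ K * z) (Finset.range N) ∪
        Finset.filter (fun p : ℕ => p ∈ P ∧ 2 ^ K * z ≤ (p : ℝ) ∧ (p : ℝ) < 2 * (2 ^ K * z))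
          (Finset.range N) := by
      intro p hp
      simp only [Finset.mem_filter, Finset.mem_union] at hp ⊢
      rcases lt_or_ge (p : ℝ) (2 ^ K * z) with h | h
      · exact Or.inl ⟨hp.1, hp.2.1, hp.2.2.1, h⟩
      · exact Or.inr ⟨hp.1, hp.2.1, h, hp.2.2.2⟩
    have h1 := Finset.sum_le_sum_of_subset_of_nonneg (f := fun p : ℕ => (1:ℝ) / p) hs
      (fun i _ _ => by positivity)
    have h2 := Finset.sum_union_inter (f := fun p : ℕ => (1:ℝ) / p)
      (s₁ := Finset.filter (fun p : ℕ => p ∈ P ∧ z ≤ (p : ℝ) ∧ (p : ℝ) < 2 ^ K * z)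
        (Finset.range N))
      (s₂ := Finset.filter (fun p : ℕ => p ∈ P ∧ 2 ^ K * z ≤ (p : ℝ) ∧ (p : ℝ) < 2 * (2 ^ K * z))
          (Finset.range N))
    have h3 : 0 ≤ ∑ p ∈ (Finset.filter (fun p : ℕ => p ∈ P ∧ z ≤ (p : ℝ) ∧ (p : ℝ) < 2 ^ K * z)
        (Finset.range N)) ∩
      (Finset.filter (fun p : ℕ => p ∈ P ∧ 2 ^ K * z ≤ (p : ℝ) ∧ (p : ℝ) < 2 * (2 ^ K * z))
          (Finset.range N)), (1:ℝ) / p := Finset.sum_nonneg fun i _ => by positivity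
    linarith

open Classical in
/-- Let `𝒫` be a set of primes, `ε ∈ (0, 1/2]`, `z₀ ≥ 2`, and assume `π_𝒫(t) ≤ ε·π(t)` for
all `t ≥ z₀`.  Then for all `x ≥ z ≥ z₀` one has
`∑_{p ∈ 𝒫, z ≤ p < x} 1/p ≪ ε·log(log x/log z) + ε`, with an absolute implied constant. -/
theorem sum_inv_primes_sparse_set :
    ∃ C : ℝ, 0 < C ∧
      ∀ (P : Set ℕ), (∀ p ∈ P, Nat.Prime p) →
        ∀ ε z₀ : ℝ, 0 < ε → ε ≤ 1 / 2 → 2 ≤ z₀ →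
          (∀ t : ℝ, z₀ ≤ t →
            (Nat.card {p : ℕ | p ∈ P ∧ (p : ℝ) ≤ t} : ℝ) ≤
              ε * (Nat.card {p : ℕ | p.Prime ∧ (p : ℝ) ≤ t} : ℝ)) →
          ∀ x z : ℝ, z₀ ≤ z → z ≤ x →
            ∑ p ∈ Finset.filter (fun p : ℕ => p ∈ P ∧ z ≤ (p : ℝ) ∧ (p : ℝ) < x)
                (Finset.range (Nat.ceil x + 1)), (1 : ℝ) / p ≤
              C * (ε * Real.log (Real.log x / Real.log z) + ε) := by
  refine ⟨18, by norm_num, ?_⟩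
  intro P _ ε z₀ hε _ hz₀ h x z hz hx
  have hz2 : 2 ≤ z := hz₀.trans hz
  obtain ⟨n, hn1, hn2⟩ := exists_nat_pow_near (x := x / z) (y := (2:ℝ))
    ((one_le_div (by linarith)).2 hx) (by norm_num)
  rw [le_div_iff₀ (by linarith)] at hn1
  rw [div_lt_iff₀ (by linarith)] at hn2
  have hi := aux_induct P ε z hε hz2 (fun t ht => h t (hz.trans ht)) (Nat.ceil x + 1) (n + 1)
  have hle : ∑ p ∈ Finset.filter (fun p : ℕ => p ∈ P ∧ z ≤ (p : ℝ) ∧ (p : ℝ) < x)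
                (Finset.range (Nat.ceil x + 1)), (1 : ℝ) / p ≤
      ∑ p ∈ Finset.filter (fun p : ℕ => p ∈ P ∧ z ≤ (p : ℝ) ∧ (p : ℝ) < 2 ^ (n + 1) * z)
                (Finset.range (Nat.ceil x + 1)), (1 : ℝ) / p := by
    refine Finset.sum_le_sum_of_subset_of_nonneg (fun p hp => ?_) (fun i _ _ => by positivity)
    simp only [Finset.mem_filter] at hp ⊢
    exact ⟨hp.1, hp.2.1, hp.2.2.1, hp.2.2.2.trans hn2⟩
  have hlz : 0 < Real.log z := Real.log_pos (by linarith)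
  have hlx : 0 < Real.log x := Real.log_pos (by linarith)
  have hl2 : Real.log 2 ≤ Real.log x := Real.log_le_log (by norm_num) (by linarith)
  have h1 : Real.log (2 ^ (n + 1) * z) ≤ 2 * Real.log x := by
    have : Real.log (2 ^ (n + 1) * z) ≤ Real.log (2 * x) :=
      Real.log_le_log (by positivity) (by rw [pow_succ]; linarith)
    rw [Real.log_mul (by norm_num) (by linarith : x ≠ 0)] at this
    linarith
  have h0 : 0 < Real.log (2 ^ (n + 1) * z) := Real.log_pos (by linarith)
  have h2 := Real.log_le_log h0 h1
  rw [Real.log_mul (by norm_num) hlx.ne'] at h2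
  rw [Real.log_div hlx.ne' hlz.ne']
  have := Real.log_two_lt_d9
  refine (hle.trans hi).trans ?_
  nlinarith
end
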